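/- For every ε > 0 there exists N such that for every integer n ≥ N there exists a conflict collection of n-vertex graphs of cardinality at most (3 + ε)·log₂(n). (Equivalently, σ(n) ≤ (3+o(1))·log₂(n), where σ(n) is the smallest size of a conflict collection of n-vertex graphs.) -/

import Mathlib

noncomputable section

/-- The Euclidean plane. -/
abbrev Plane := EuclideanSpace ℝ (Fin 2)

/-- `π` is a straight-line embedding of the simple graph `G` in the plane:
it is injective, the closed segments of two distinct edges meet only in images of
common endpoints, and no vertex image lies in the open segment of a non-incident edge. -/
def IsSLEmbedding {V : Type*} (G : SimpleGraph V) (π : V → Plane) : Prop :=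
  Function.Injective π ∧
  (∀ u v x y : V, G.Adj u v → G.Adj x y → s(u, v) ≠ s(x, y) →
    segment ℝ (π u) (π v) ∩ segment ℝ (π x) (π y) ⊆ π '' (({u, v} : Set V) ∩ ({x, y} : Set V))) ∧
  (∀ u v w : V, G.Adj u v → w ≠ u → w ≠ v → π w ∉ openSegment ℝ (π u) (π v))

/-- `G` embeds straight-line on the point set `P`. -/
def EmbedsOn {V : Type*} (G : SimpleGraph V) (P : Set Plane) : Prop :=
  ∃ π : V → Plane, IsSLEmbedding G π ∧ Set.range π = P

/-- `G` embeds straight-line on some point set (equivalently, `G` is planar). -/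
def PlanarEmbeddable {V : Type*} (G : SimpleGraph V) : Prop :=
  ∃ π : V → Plane, IsSLEmbedding G π

/-- A family of graphs on `n` vertices is simultaneously embeddable if there is a point
set of size `n` on which every member embeds straight-line. -/
def SimultaneouslyEmbeddable {n : ℕ} (𝒢 : Set (SimpleGraph (Fin n))) : Prop :=
  ∃ P : Finset Plane, P.card = n ∧ ∀ G ∈ 𝒢, EmbedsOn G ↑P

/-- A conflict collection: a family of planar-embeddable graphs on `n` vertices that is
not simultaneously embeddable. -/
def ConflictCollection {n : ℕ} (𝒢 : Set (SimpleGraph (Fin n))) : Prop :=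
  (∀ G ∈ 𝒢, PlanarEmbeddable G) ∧ ¬ SimultaneouslyEmbeddable 𝒢

section

open MvPolynomial

theorem exists_exp_bound_eval {ι : Type*} [Fintype ι] (p : MvPolynomial ι ℝ) :
    ∃ C k : ℝ, 0 ≤ C ∧ 0 ≤ k ∧ ∀ x : ι → ℝ, |eval x p| ≤ C * Real.exp (k * ∑ i, |x i|) := by
  induction p using MvPolynomial.induction_on with
  | C a => exact ⟨|a|, 0, abs_nonneg a, le_rfl, fun x => by simp⟩
  | add p q hp hq =>
    obtain ⟨C₁, k₁, hC₁, hk₁, h₁⟩ := hp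
    obtain ⟨C₂, k₂, hC₂, hk₂, h₂⟩ := hq
    refine ⟨C₁ + C₂, k₁ + k₂, by positivity, by positivity, fun x => ?_⟩
    have hs : 0 ≤ ∑ i, |x i| := Finset.sum_nonneg fun i _ => abs_nonneg _
    rw [map_add, add_mul]
    refine (abs_add_le _ _).trans (add_le_add ((h₁ x).trans ?_) ((h₂ x).trans ?_))
    · gcongr; linarith
    · gcongr; linarith
  | mul_X p i hp =>
    obtain ⟨C₁, k₁, hC₁, hk₁, h₁⟩ := hp
    refine ⟨C₁, k₁ + 1, hC₁, by positivity, fun x => ?_⟩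
    have hi : |x i| ≤ ∑ i, |x i| :=
      Finset.single_le_sum (f := fun i => |x i|) (fun i _ => abs_nonneg _) (Finset.mem_univ i)
    have he : |x i| ≤ Real.exp (∑ i, |x i|) := by
      have := Real.add_one_le_exp (∑ i, |x i|)
      linarith
    rw [map_mul, eval_X, abs_mul, add_mul, Real.exp_add, one_mul, ← mul_assoc]
    exact mul_le_mul (h₁ x) he (abs_nonneg _) (by positivity)

theorem hasDerivAt_eval_update {ι : Type*} [DecidableEq ι] (p : MvPolynomial ι ℝ) (x : ι → ℝ)
    (i : ι) :
    HasDerivAt (fun t => eval (Function.update x i t) p) (eval x (pderiv i p)) (x i) := by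
  induction p using MvPolynomial.induction_on with
  | C a => simpa using hasDerivAt_const (x i) a
  | add p q hp hq => simpa using hp.fun_add hq
  | mul_X p j hp =>
    have hj : HasDerivAt (fun t => Function.update x i t j) (eval x (pderiv i (X j))) (x i) := by
      rcases eq_or_ne j i with rfl | h
      · simpa using hasDerivAt_id' (x j)
      · simpa [h, pderiv_X_of_ne h] using hasDerivAt_const (x i) (x j)
    have := hp.fun_mul hj
    simp only [Function.update_eq_self] at this
    simpa [pderiv_mul, add_comm, mul_comm] using this

/-- In every sign cell of a family of polynomials, `log |∏ f| - |x|²/2 + ⟨y, x⟩` has a critical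
point, for every `y`. -/
theorem exists_critical_point {ι J : Type*} [Fintype ι] [DecidableEq ι] [Fintype J]
    (f : J → MvPolynomial ι ℝ) (z : ι → ℝ) (hz : ∀ j, eval z (f j) ≠ 0) (y : ι → ℝ) :
    ∃ x : ι → ℝ, (∀ j, 0 < eval z (f j) * eval x (f j)) ∧
      ∀ i, eval x (pderiv i (∏ j, f j)) = (x i - y i) * eval x (∏ j, f j) := by
  set p := ∏ j, f j with hp
  set e : (ι → ℝ) → ℝ := fun x => ∑ i, (y i * x i - x i ^ 2 / 2) with he
  set Ψ : (ι → ℝ) → ℝ := fun x => eval z p * eval x p * Real.exp (e x) with hΨ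
  have hcont : Continuous Ψ := by
    have := MvPolynomial.continuous_eval p
    fun_prop
  have hpz : eval z p ≠ 0 := by
    rw [hp, eval_prod]; exact Finset.prod_ne_zero_iff.2 fun j _ => hz j
  have hΨz : 0 < Ψ z := mul_pos (mul_self_pos.2 hpz) (Real.exp_pos _)
  set K : Set (ι → ℝ) := {x | (∀ j, 0 ≤ eval z (f j) * eval x (f j)) ∧ Ψ z ≤ Ψ x} with hK
  have hKclosed : IsClosed K := by
    have : K = (⋂ j, {x | 0 ≤ eval z (f j) * eval x (f j)}) ∩ {x | Ψ z ≤ Ψ x} := by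
      ext x; simp [hK]
    rw [this]
    exact (isClosed_iInter fun j => isClosed_le continuous_const
      (continuous_const.mul (MvPolynomial.continuous_eval (f j)))).inter
      (isClosed_le continuous_const hcont)
  have hKbdd : Bornology.IsBounded K := by
    obtain ⟨C, k, hC, hk, hb⟩ := exists_exp_bound_eval p
    set M : ℝ := ∑ i, (k + |y i|) ^ 2 with hM
    set L : ℝ := Real.log (Ψ z / (|eval z p| * C + 1)) with hL
    have hden : 0 < |eval z p| * C + 1 := by positivity
    refine (Metric.isBounded_closedBall (x := (0 : ι → ℝ)) (r := 4 * (M - L) + 1)).subset ?_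
    rintro x ⟨-, hx⟩
    have h1 : Ψ x ≤ (|eval z p| * C + 1) * Real.exp (M - ∑ i, x i ^ 2 / 4) := by
      have h2 : k * ∑ i, |x i| + e x ≤ M - ∑ i, x i ^ 2 / 4 := by
        rw [he, hM, Finset.mul_sum, ← Finset.sum_add_distrib, ← Finset.sum_sub_distrib]
        refine Finset.sum_le_sum fun i _ => ?_
        have h3 : y i * x i ≤ |y i| * |x i| := by rw [← abs_mul]; exact le_abs_self _
        have h4 : x i ^ 2 = |x i| ^ 2 := (sq_abs _).symm
        rw [h4]
        nlinarith [sq_nonneg (k + |y i| - |x i| / 2)]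
      calc Ψ x ≤ |eval z p| * |eval x p| * Real.exp (e x) := by
            rw [← abs_mul]; exact mul_le_mul_of_nonneg_right (le_abs_self _) (Real.exp_pos _).le
        _ ≤ |eval z p| * (C * Real.exp (k * ∑ i, |x i|)) * Real.exp (e x) := by
            gcongr; exact hb x
        _ = |eval z p| * C * Real.exp (k * ∑ i, |x i| + e x) := by rw [Real.exp_add]; ring
        _ ≤ (|eval z p| * C + 1) * Real.exp (M - ∑ i, x i ^ 2 / 4) := by
            gcongr; linarith
    have h5 : L ≤ M - ∑ i, x i ^ 2 / 4 := by
      rw [hL, Real.log_le_iff_le_exp (by positivity), div_le_iff₀ hden]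
      linarith
    have h6 : ∀ i, x i ^ 2 ≤ 4 * (M - L) := fun i => by
      have := Finset.single_le_sum (f := fun i => x i ^ 2 / 4) (fun i _ => by positivity)
        (Finset.mem_univ i)
      linarith
    have h7 : 0 ≤ M - L := by
      have : 0 ≤ ∑ i, x i ^ 2 / 4 := Finset.sum_nonneg fun i _ => by positivity
      linarith
    rw [mem_closedBall_zero_iff, pi_norm_le_iff_of_nonneg (by linarith)]
    intro i
    rw [Real.norm_eq_abs]
    refine abs_le_of_sq_le_sq ?_ (by linarith)
    nlinarith [h6 i]
  have hKne : K.Nonempty := ⟨z, fun j => mul_self_nonneg _, le_rfl⟩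
  obtain ⟨x, hxK, hmax⟩ :=
    (Metric.isCompact_of_isClosed_isBounded hKclosed hKbdd).exists_isMaxOn hKne hcont.continuousOn
  have hpx : eval x p ≠ 0 := by
    intro h0
    have := hxK.2
    simp only [hΨ, h0, mul_zero, zero_mul] at this
    exact absurd this (not_le.2 hΨz)
  have hpos : ∀ j, 0 < eval z (f j) * eval x (f j) := by
    intro j
    have hj : eval x (f j) ≠ 0 := by
      rw [hp, eval_prod, Finset.prod_ne_zero_iff] at hpx
      exact hpx j (Finset.mem_univ j)
    exact lt_of_le_of_ne (hxK.1 j) (mul_ne_zero (hz j) hj).symm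
  refine ⟨x, hpos, fun i => ?_⟩
  have hloc : IsLocalMax Ψ x := by
    have hev : ∀ᶠ w in nhds x, ∀ j, 0 < eval z (f j) * eval w (f j) := by
      rw [Filter.eventually_all]
      exact fun j => (continuous_const.mul (continuous_eval (f j))).continuousAt.eventually
        (lt_mem_nhds (hpos j))
    filter_upwards [hev] with w hw
    rcases le_total (Ψ z) (Ψ w) with h | h
    · exact hmax ⟨fun j => (hw j).le, h⟩
    · exact h.trans hxK.2
  have hloc' : IsLocalMax (fun t => Ψ (Function.update x i t)) (x i) := by
    have hc : ContinuousAt (fun t => Function.update x i t) (x i) := by fun_prop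
    have := hc.eventually (p := fun w => Ψ w ≤ Ψ x)
      (by simp only [Function.update_eq_self]; exact hloc)
    simpa [IsLocalMax, IsMaxFilter] using this
  have hde : HasDerivAt (fun t => e (Function.update x i t)) (y i - x i) (x i) := by
    have h : ∀ l ∈ Finset.univ, HasDerivAt (fun t => y l * Function.update x i t l -
        Function.update x i t l ^ 2 / 2) (if l = i then y i - x i else 0) (x i) := by
      intro l _
      rcases eq_or_ne l i with rfl | hl
      · simp only [Function.update_self, if_true]
        have := ((hasDerivAt_id' (x l)).const_mul (y l)).fun_sub
          (((hasDerivAt_id' (x l)).fun_pow 2).div_const 2)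
        exact this.congr_deriv (by simp)
      · simp only [Function.update_of_ne hl, if_neg hl]
        exact hasDerivAt_const _ _
    have := HasDerivAt.fun_sum h
    rwa [Finset.sum_ite_eq' Finset.univ i, if_pos (Finset.mem_univ i)] at this
  have hd := ((hasDerivAt_eval_update p x i).const_mul (eval z p)).mul hde.exp
  have h0 := hloc'.hasDerivAt_eq_zero hd
  simp only [Function.update_eq_self] at h0
  have h1 : eval z p * Real.exp (e x) * (eval x (pderiv i p) + eval x p * (y i - x i)) = 0 := by
    linear_combination h0
  have h2 := (mul_eq_zero.1 h1).resolve_left (mul_ne_zero hpz (Real.exp_pos _).ne')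
  linarith

/-- A finite set of linear forms which separates any configuration of `card S` points. -/
theorem exists_finset_separating (ι S : Type*) [Fintype ι] [Fintype S] :
    ∃ Θ : Finset (ι → ℝ), ∀ x : S → ι → ℝ, Function.Injective x →
      ∃ w ∈ Θ, Function.Injective fun s => ∑ i, w i * x s i := by
  classical
  set e := Fintype.equivFin ι
  set M := (Finset.univ : Finset S).offDiag.card * Fintype.card ι
  refine ⟨(Finset.range (M + 1)).image fun (m : ℕ) (i : ι) => (m : ℝ) ^ (e i : ℕ), fun x hx => ?_⟩
  by_contra! hcon
  set g : S × S → Polynomial ℝ := fun st =>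
    ∑ i, Polynomial.C (x st.1 i - x st.2 i) * Polynomial.X ^ (e i : ℕ) with hg
  set Q : Polynomial ℝ := ∏ st ∈ (Finset.univ : Finset S).offDiag, g st with hQ
  have hQ0 : Q ≠ 0 := by
    refine Finset.prod_ne_zero_iff.2 fun st hst h0 => ?_
    rw [Finset.mem_offDiag] at hst
    refine hst.2.2 (hx (funext fun i => ?_))
    have h1 := congrArg (fun p => Polynomial.coeff p (e i : ℕ)) h0
    simp only [hg, Polynomial.finsetSum_coeff, Polynomial.coeff_C_mul, Polynomial.coeff_X_pow,
      Polynomial.coeff_zero] at h1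
    rw [Finset.sum_eq_single i] at h1
    · simpa [sub_eq_zero] using h1
    · intro l _ hl
      rw [if_neg, mul_zero]
      exact fun h => hl (e.injective (Fin.ext h.symm))
    · simp
  have hdeg : Q.natDegree ≤ M := by
    refine (Polynomial.natDegree_prod_le _ _).trans ?_
    refine (Finset.sum_le_card_nsmul _ _ (Fintype.card ι) fun st _ => ?_).trans (by simp [M])
    refine Polynomial.natDegree_sum_le_of_forall_le _ _ fun i _ => ?_
    exact (Polynomial.natDegree_C_mul_X_pow_le _ _).trans (e i).2.le
  refine hQ0 (Polynomial.eq_zero_of_natDegree_lt_card_of_eval_eq_zero' Q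
    ((Finset.range (M + 1)).image fun m : ℕ => (m : ℝ)) ?_ ?_)
  · intro r hr
    obtain ⟨m, hm, rfl⟩ := Finset.mem_image.1 hr
    have := hcon _ (Finset.mem_image_of_mem (fun (m : ℕ) (i : ι) => (m : ℝ) ^ (e i : ℕ)) hm)
    simp only [Function.Injective, not_forall] at this
    obtain ⟨s, t, hst, hne⟩ := this
    rw [hQ, Polynomial.eval_prod]
    refine Finset.prod_eq_zero (i := (s, t)) (by simp [hne]) ?_
    simp only [hg, Polynomial.eval_finsetSum, Polynomial.eval_mul, Polynomial.eval_C,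
      Polynomial.eval_pow, Polynomial.eval_X]
    rw [← sub_eq_zero, ← Finset.sum_sub_distrib] at hst
    rw [← hst]
    exact Finset.sum_congr rfl fun i _ => by ring
  · rw [Finset.card_image_of_injective _ Nat.cast_injective, Finset.card_range]
    omega

theorem exists_linear_relation_of_degreeOf_le {ι A : Type*} [Fintype ι] [Fintype A] (D : ℕ)
    (P : A → MvPolynomial ι ℝ) (hdeg : ∀ a l, degreeOf l (P a) ≤ D)
    (hcard : (D + 1) ^ Fintype.card ι < Fintype.card A) :
    ∃ c : A → ℝ, (∃ a, c a ≠ 0) ∧ ∑ a, C (c a) * P a = 0 := by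
  classical
  set v : A → (ι → Fin (D + 1)) → ℝ := fun a b =>
    coeff (Finsupp.equivFunOnFinite.symm fun i => (b i : ℕ)) (P a) with hv
  have hdep : ¬ LinearIndependent ℝ v := by
    intro h
    have := h.fintype_card_le_finrank
    rw [Module.finrank_fintype_fun_eq_card, Fintype.card_fun, Fintype.card_fin] at this
    omega
  obtain ⟨c, hc, hne⟩ := Fintype.not_linearIndependent_iff.1 hdep
  refine ⟨c, hne, MvPolynomial.ext _ _ fun m => ?_⟩
  rw [coeff_sum, coeff_zero]
  simp only [coeff_C_mul]
  by_cases hm : ∀ i, m i ≤ D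
  · have := congrFun hc fun i => ⟨m i, Nat.lt_succ_of_le (hm i)⟩
    have hm' : (Finsupp.equivFunOnFinite.symm fun i => m i) = m := by ext i; simp
    simpa [hv, hm'] using this
  · push Not at hm
    obtain ⟨i, hi⟩ := hm
    refine Finset.sum_eq_zero fun a _ => ?_
    rw [notMem_support_iff.1 (notMem_support_of_degreeOf_lt i ((hdeg a i).trans_lt hi)), mul_zero]

theorem degreeOf_pderiv_le {ι : Type*} (p : MvPolynomial ι ℝ) (i l : ι) :
    degreeOf l (pderiv i p) ≤ degreeOf l p := by
  rw [degreeOf_le_iff]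
  intro m hm
  rw [mem_support_iff, coeff_pderiv] at hm
  have := le_degreeOf_of_mem_support l (mem_support_iff.2 (left_ne_zero_of_mul hm))
  simp only [Finsupp.add_apply] at this
  omega

/-- A bound on the number of sign cells of a family of polynomials in terms of partial degrees.
`q i` collects the factors of `∏ j, f j` which depend on the variable `i`. -/
theorem card_lt_of_sign_separated {ι J S : Type*} [Fintype ι] [Nonempty ι] [Fintype J] [Fintype S]
    (f : J → MvPolynomial ι ℝ) (q r : ι → MvPolynomial ι ℝ)
    (hqr : ∀ i, ∏ j, f j = q i * r i) (hr : ∀ i, pderiv i (r i) = 0) (Δ : ℕ)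
    (hΔ : ∀ l, ∑ i, degreeOf l (q i) ≤ Δ) (z : S → ι → ℝ) (hz : ∀ s j, eval (z s) (f j) ≠ 0)
    (hsep : ∀ s t, s ≠ t → ∃ j, eval (z s) (f j) * eval (z t) (f j) < 0) :
    Fintype.card S < (Δ + 2) ^ Fintype.card ι := by
  classical
  obtain ⟨Θ, hΘ⟩ := exists_finset_separating ι S
  set N := Fintype.card ι with hN
  obtain ⟨R, hR⟩ : ∃ R, (Δ + 2) ^ N = R + 1 :=
    ⟨(Δ + 2) ^ N - 1, (Nat.succ_pred_eq_of_pos (by positivity)).symm⟩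
  set g : ι → MvPolynomial ι ℝ := fun i => X i * q i - pderiv i (q i) with hg
  set u : (ι → ℝ) → MvPolynomial ι ℝ := fun w => ∑ i, C (w i) * X i with hu
  set P : (ι → ℝ) → (Fin (R + 1) × (ι → Fin (R + 1))) → MvPolynomial ι ℝ := fun w ab =>
    u w ^ (ab.1 : ℕ) * ∏ i, g i ^ (ab.2 i : ℕ) * q i ^ (R - ab.2 i) with hP
  have hdegu : ∀ w l, degreeOf l (u w) ≤ 1 := by
    intro w l
    refine (degreeOf_sum_le _ _ _).trans (Finset.sup_le fun i _ => ?_)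
    refine (degreeOf_C_mul_le _ _ _).trans ?_
    rw [degreeOf_X]; split_ifs <;> simp
  have hdegg : ∀ i l, degreeOf l (g i) ≤ degreeOf l (q i) + if l = i then 1 else 0 := by
    intro i l
    refine (degreeOf_sub_le _ _ _).trans (max_le ?_ ?_)
    · refine (degreeOf_mul_le _ _ _).trans ?_
      rw [degreeOf_X, add_comm]
    · exact (degreeOf_pderiv_le _ _ _).trans (Nat.le_add_right _ _)
  have hdegP : ∀ w ab l, degreeOf l (P w ab) ≤ R * (Δ + 2) := by
    rintro w ⟨a, b⟩ l
    have ha : degreeOf l (u w ^ (a : ℕ)) ≤ R := by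
      refine (degreeOf_pow_le _ _ _).trans ?_
      have := hdegu w l
      have := a.2
      nlinarith
    have hi : ∀ i, degreeOf l (g i ^ (b i : ℕ) * q i ^ (R - b i)) ≤
        R * degreeOf l (q i) + if l = i then R else 0 := by
      intro i
      refine (degreeOf_mul_le _ _ _).trans ((add_le_add (degreeOf_pow_le _ _ _)
        (degreeOf_pow_le _ _ _)).trans ?_)
      have hb : (b i : ℕ) ≤ R := Nat.lt_succ_iff.1 (b i).2
      obtain ⟨c, hc⟩ := Nat.exists_eq_add_of_le hb
      have h1 := hdegg i l
      have h2 : (b i : ℕ) * degreeOf l (g i) ≤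
        b i * (degreeOf l (q i) + if l = i then 1 else 0) := Nat.mul_le_mul_left _ h1
      have h3 : R - b i = c := by omega
      rw [h3]
      split_ifs at h2 ⊢ <;> nlinarith
    calc degreeOf l (P w (a, b)) ≤ R + ∑ i, (R * degreeOf l (q i) + if l = i then R else 0) :=
          (degreeOf_mul_le _ _ _).trans (add_le_add ha
            ((degreeOf_prod_le _ _ _).trans (Finset.sum_le_sum fun i _ => hi i)))
      _ = R + (R * ∑ i, degreeOf l (q i) + R) := by
          rw [Finset.sum_add_distrib, Finset.mul_sum, Finset.sum_ite_eq, if_pos (Finset.mem_univ l)]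
      _ ≤ R * (Δ + 2) := by nlinarith [hΔ l]
  have hcard : (R * (Δ + 2) + 1) ^ Fintype.card ι <
      Fintype.card (Fin (R + 1) × (ι → Fin (R + 1))) := by
    rw [Fintype.card_prod, Fintype.card_fun, Fintype.card_fin, ← hN]
    calc (R * (Δ + 2) + 1) ^ N < ((Δ + 2) * (R + 1)) ^ N :=
          Nat.pow_lt_pow_left (by nlinarith) Fintype.card_ne_zero
      _ = (R + 1) * (R + 1) ^ N := by rw [mul_pow, hR]
  choose c hcne hc using fun w => exists_linear_relation_of_degreeOf_le _ (P w) (hdegP w) hcard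
  choose ab hab using hcne
  set E : (ι → Fin (R + 1)) → ι →₀ ℕ := fun b => Finsupp.equivFunOnFinite.symm fun i => (b i : ℕ)
    with hE
  have hEinj : Function.Injective E := by
    intro b b' h
    funext i
    have := DFunLike.congr_fun h i
    simpa [hE, Fin.ext_iff] using this
  set Λ : (ι → ℝ) → Fin (R + 1) → MvPolynomial ι ℝ := fun w a =>
    ∑ b, monomial (E b) (c w (a, b)) with hΛ
  have hΛne : ∀ w, Λ w (ab w).1 ≠ 0 := by
    intro w h0
    have := congrArg (coeff (E (ab w).2)) h0
    simp only [hΛ, coeff_sum, coeff_monomial, hEinj.eq_iff, coeff_zero] at this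
    simp only [Finset.sum_ite_eq', Finset.mem_univ, if_true] at this
    exact hab w this
  obtain ⟨y, hy⟩ : ∃ y, eval y (∏ w ∈ Θ, Λ w (ab w).1) ≠ 0 := by
    by_contra! h
    exact Finset.prod_ne_zero_iff.2 (fun w _ => hΛne w)
      (MvPolynomial.funext fun y => by rw [h y, map_zero])
  rw [eval_prod, Finset.prod_ne_zero_iff] at hy
  choose x hxpos hxcrit using fun s => exists_critical_point f (z s) (hz s) y
  have hxinj : Function.Injective x := by
    intro s t hst
    by_contra hne
    obtain ⟨j, hj⟩ := hsep s t hne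
    have h1 := hxpos s j
    have h2 := hxpos t j
    rw [hst] at h1
    nlinarith [mul_pos h1 h2, mul_self_nonneg (eval (x t) (f j))]
  obtain ⟨w, hw, hinj⟩ := hΘ x hxinj
  have hpx : ∀ s, eval (x s) (∏ j, f j) ≠ 0 := fun s => by
    rw [eval_prod]
    exact Finset.prod_ne_zero_iff.2 fun j _ => right_ne_zero_of_mul (hxpos s j).ne'
  have hqx : ∀ s i, eval (x s) (q i) ≠ 0 := fun s i => by
    have := hpx s
    rw [hqr i, map_mul] at this
    exact left_ne_zero_of_mul this
  have hgx : ∀ s i, eval (x s) (g i) = y i * eval (x s) (q i) := fun s i => by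
    have h1 := hxcrit s i
    have h2 := hpx s
    rw [hqr i, map_mul] at h2
    rw [hqr i, pderiv_mul, hr, mul_zero, add_zero, map_mul, map_mul] at h1
    have h3 : eval (x s) (pderiv i (q i)) = (x s i - y i) * eval (x s) (q i) :=
      mul_right_cancel₀ (right_ne_zero_of_mul h2) (by rw [h1]; ring)
    rw [hg]
    simp only [map_sub, map_mul, eval_X, h3]
    ring
  set Q : Polynomial ℝ := ∑ a : Fin (R + 1), Polynomial.C (eval y (Λ w a)) *
    Polynomial.X ^ (a : ℕ) with hQ
  have hQne : Q ≠ 0 := by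
    intro h0
    have := congrArg (fun p => Polynomial.coeff p ((ab w).1 : ℕ)) h0
    simp only [hQ, Polynomial.finsetSum_coeff, Polynomial.coeff_C_mul, Polynomial.coeff_X_pow,
      Polynomial.coeff_zero, ← Fin.ext_iff, mul_ite, mul_one, mul_zero, Finset.sum_ite_eq,
      Finset.mem_univ, if_true] at this
    exact hy w hw this
  have hQdeg : Q.natDegree ≤ R :=
    Polynomial.natDegree_sum_le_of_forall_le _ _ fun a _ =>
      (Polynomial.natDegree_C_mul_X_pow_le _ _).trans (Nat.lt_succ_iff.1 a.2)
  have hroot : ∀ s, Q.eval (∑ i, w i * x s i) = 0 := by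
    intro s
    have h1 := congrArg (eval (x s)) (hc w)
    have hux : eval (x s) (u w) = ∑ i, w i * x s i := by simp [hu]
    have h2 : ∀ t : Fin (R + 1) × (ι → Fin (R + 1)), eval (x s) (C (c w t) * P w t) =
        (c w t * (∑ i, w i * x s i) ^ (t.1 : ℕ) * ∏ i, y i ^ (t.2 i : ℕ)) *
          ∏ i, eval (x s) (q i) ^ R := by
      rintro ⟨a, b⟩
      simp only [hP, map_mul, eval_C, map_pow, eval_prod, hux, hgx]
      rw [mul_assoc, mul_assoc, ← Finset.prod_mul_distrib]
      congr 2
      refine Finset.prod_congr rfl fun i _ => ?_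
      rw [mul_pow, mul_assoc, ← pow_add, Nat.add_sub_cancel' (Nat.lt_succ_iff.1 (b i).2)]
    rw [map_sum, map_zero, Finset.sum_congr rfl fun t _ => h2 t, ← Finset.sum_mul] at h1
    have h3 := (mul_eq_zero.1 h1).resolve_right
      (Finset.prod_ne_zero_iff.2 fun i _ => pow_ne_zero _ (hqx s i))
    rw [Fintype.sum_prod_type] at h3
    rw [← h3, hQ, Polynomial.eval_finsetSum]
    refine Finset.sum_congr rfl fun a _ => ?_
    rw [Polynomial.eval_mul, Polynomial.eval_C, Polynomial.eval_pow, Polynomial.eval_X]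
    simp only [hΛ, map_sum, Finset.sum_mul]
    refine Finset.sum_congr rfl fun b _ => ?_
    rw [eval_monomial, Finsupp.prod_fintype _ _ (fun i => pow_zero _)]
    simp only [hE, Finsupp.equivFunOnFinite_symm_apply_apply]
    ring
  by_contra! hle
  refine hQne (Polynomial.eq_zero_of_natDegree_lt_card_of_eval_eq_zero Q hinj hroot ?_)
  omega

end

/-- Twice the signed area of the triangle `p q r`. -/
def orient (p q r : Plane) : ℝ :=
  (q 0 - p 0) * (r 1 - p 1) - (q 1 - p 1) * (r 0 - p 0)

/-- Whether the triangle `p q r` is positively oriented. -/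
def ccw (p q r : Plane) : Bool :=
  decide (0 < orient p q r)

theorem ccw_perm {p q r : Plane} (h : orient p q r ≠ 0) :
    ccw q r p = ccw p q r ∧ ccw r p q = ccw p q r ∧ ccw q p r = !ccw p q r ∧
      ccw p r q = !ccw p q r ∧ ccw r q p = !ccw p q r := by
  have h1 : orient q r p = orient p q r := by unfold orient; ring
  have h2 : orient r p q = orient p q r := by unfold orient; ring
  have h3 : orient q p r = -orient p q r := by unfold orient; ring
  have h4 : orient p r q = -orient p q r := by unfold orient; ring
  have h5 : orient r q p = -orient p q r := by unfold orient; ring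
  unfold ccw
  rw [h1, h2, h3, h4, h5]
  rcases lt_or_gt_of_ne h with h | h <;> simp [h, h.le]

/-- Signs of `w, x, y, z` which are compatible with `w - z + y - x = 0`. -/
def affineSigns (x y z w : Bool) : Bool :=
  !((w == y) && (z == !w) && (x == !w))

/-- Signs which are compatible with `x₁ * y₁ - x₂ * y₂ + x₃ * y₃ = 0`. -/
def pluckerSigns (x₁ y₁ x₂ y₂ x₃ y₃ : Bool) : Bool :=
  !(((x₁ == y₁) == (x₃ == y₃)) && ((x₂ == y₂) == !(x₁ == y₁)))

/-- Sign consequence of the affine dependency of the four triangles spanned by `a b c d`. -/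
theorem ccw_affine {a b c d : Plane} (h₁ : orient a b c ≠ 0) (h₂ : orient a b d ≠ 0)
    (h₃ : orient a c d ≠ 0) (h₄ : orient b c d ≠ 0) :
    affineSigns (ccw a b c) (ccw a b d) (ccw a c d) (ccw b c d) = true := by
  have h : orient b c d - orient a c d + orient a b d - orient a b c = 0 := by unfold orient; ring
  unfold affineSigns ccw
  rcases lt_or_gt_of_ne h₁ with h₁ | h₁ <;> rcases lt_or_gt_of_ne h₂ with h₂ | h₂ <;>
  rcases lt_or_gt_of_ne h₃ with h₃ | h₃ <;> rcases lt_or_gt_of_ne h₄ with h₄ | h₄ <;>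
  simp [h₁, h₂, h₃, h₄, h₁.not_gt, h₂.not_gt, h₃.not_gt, h₄.not_gt] <;> linarith

theorem ccw_beq {a b c d e f : Plane} (h₁ : orient a b c ≠ 0) (h₂ : orient d e f ≠ 0) :
    (ccw a b c == ccw d e f) = decide (0 < orient a b c * orient d e f) := by
  unfold ccw
  rcases lt_or_gt_of_ne h₁ with h₁ | h₁ <;> rcases lt_or_gt_of_ne h₂ with h₂ | h₂
  · simp [h₁.not_gt, h₂.not_gt, mul_pos_of_neg_of_neg h₁ h₂]
  · simp [h₁.not_gt, h₂, (mul_neg_of_neg_of_pos h₁ h₂).not_gt]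
  · simp [h₁, h₂.not_gt, (mul_neg_of_pos_of_neg h₁ h₂).not_gt]
  · simp [h₁, h₂, mul_pos h₁ h₂]

/-- Sign consequence of the three-term Grassmann–Plücker relation. -/
theorem ccw_grassmannPlucker {p a b c d : Plane} (hab : orient p a b ≠ 0) (hac : orient p a c ≠ 0)
    (had : orient p a d ≠ 0) (hbc : orient p b c ≠ 0) (hbd : orient p b d ≠ 0)
    (hcd : orient p c d ≠ 0) :
    pluckerSigns (ccw p a b) (ccw p c d) (ccw p a c) (ccw p b d) (ccw p a d)
      (ccw p b c) = true := by
  have h : orient p a b * orient p c d - orient p a c * orient p b d +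
    orient p a d * orient p b c = 0 := by unfold orient; ring
  unfold pluckerSigns
  rw [ccw_beq hab hcd, ccw_beq had hbc, ccw_beq hac hbd]
  have h₁ := mul_ne_zero hab hcd
  have h₂ := mul_ne_zero hac hbd
  have h₃ := mul_ne_zero had hbc
  rcases lt_or_gt_of_ne h₁ with h₁ | h₁ <;> rcases lt_or_gt_of_ne h₂ with h₂ | h₂ <;>
  rcases lt_or_gt_of_ne h₃ with h₃ | h₃ <;>
  simp [h₁, h₂, h₃, h₁.not_gt, h₂.not_gt, h₃.not_gt] <;> linarith

/-- Sign condition for `x` to lie inside the triangle `a b c`. -/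
def insideTri (a b c x : Plane) : Bool :=
  (ccw a b x == ccw a b c) && (ccw b c x == ccw a b c) && (ccw c a x == ccw a b c)

/-- Sign condition for the segments `u v` and `x y` to cross. -/
def crossing (u v x y : Plane) : Bool :=
  (ccw u v x != ccw u v y) && (ccw x y u != ccw x y v)

/-- `x` and `d` lie on different sides of the triangle `a b c`. -/
def opposite (a b c d x : Plane) : Bool :=
  insideTri a b c x != insideTri a b c d

/-- General position for five points. -/
structure GeneralPosition (a b c d e : Plane) : Prop where
  abc : orient a b c ≠ 0
  abd : orient a b d ≠ 0
  abe : orient a b e ≠ 0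
  acd : orient a c d ≠ 0
  ace : orient a c e ≠ 0
  ade : orient a d e ≠ 0
  bcd : orient b c d ≠ 0
  bce : orient b c e ≠ 0
  bde : orient b d e ≠ 0
  cde : orient c d e ≠ 0

theorem orient_swap_ne {p q r : Plane} (h : orient p q r ≠ 0) : orient q p r ≠ 0 := by
  have h3 : orient q p r = -orient p q r := by unfold orient; ring
  rwa [h3, neg_ne_zero]

theorem orient_rot_ne {p q r : Plane} (h : orient p q r ≠ 0) : orient r p q ≠ 0 := by
  have h3 : orient r p q = orient p q r := by unfold orient; ring
  rwa [h3]

/-- The chirotope conditions for five points, in terms of sorted triples. -/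
def isChirotope (abc abd abe acd ace ade bcd bce bde cde : Bool) : Bool :=
  pluckerSigns abc ade abd ace abe acd &&
  pluckerSigns (!abc) bde (!abd) bce (!abe) bcd &&
  pluckerSigns abc cde (!acd) (!bce) (!ace) (!bcd) &&
  pluckerSigns abd (!cde) acd (!bde) (!ade) bcd &&
  pluckerSigns abe cde ace bde ade bce &&
  affineSigns abc abd acd bcd && affineSigns abc abe ace bce && affineSigns abd abe ade bde &&
  affineSigns acd ace ade cde && affineSigns bcd bce bde cde

theorem GeneralPosition.isChirotope {a b c d e : Plane} (h : GeneralPosition a b c d e) :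
    isChirotope (ccw a b c) (ccw a b d) (ccw a b e) (ccw a c d) (ccw a c e) (ccw a d e) (ccw b c d)
      (ccw b c e) (ccw b d e) (ccw c d e) = true := by
  have ga := ccw_grassmannPlucker h.abc h.abd h.abe h.acd h.ace h.ade
  have gb := ccw_grassmannPlucker (orient_swap_ne h.abc) (orient_swap_ne h.abd)
    (orient_swap_ne h.abe) h.bcd h.bce h.bde
  have gc := ccw_grassmannPlucker (orient_rot_ne h.abc) (orient_swap_ne h.acd)
    (orient_swap_ne h.ace) (orient_swap_ne h.bcd) (orient_swap_ne h.bce) h.cde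
  have gd := ccw_grassmannPlucker (orient_rot_ne h.abd) (orient_rot_ne h.acd) (orient_swap_ne h.ade)
    (orient_rot_ne h.bcd) (orient_swap_ne h.bde) (orient_swap_ne h.cde)
  have ge := ccw_grassmannPlucker (orient_rot_ne h.abe) (orient_rot_ne h.ace) (orient_rot_ne h.ade)
    (orient_rot_ne h.bce) (orient_rot_ne h.bde) (orient_rot_ne h.cde)
  have fabcd := ccw_affine h.abc h.abd h.acd h.bcd
  have fabce := ccw_affine h.abc h.abe h.ace h.bce
  have fabde := ccw_affine h.abd h.abe h.ade h.bde
  have facde := ccw_affine h.acd h.ace h.ade h.cde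
  have fbcde := ccw_affine h.bcd h.bce h.bde h.cde
  simp only [ccw_perm h.abc, ccw_perm h.abd, ccw_perm h.abe, ccw_perm h.acd, ccw_perm h.ace,
    ccw_perm h.ade, ccw_perm h.bcd, ccw_perm h.bce, ccw_perm h.bde, ccw_perm h.cde] at *
  unfold _root_.isChirotope
  simp only [ga, gb, gc, gd, ge, fabcd, fabce, fabde, facde, fbcde, Bool.and_self]

/-- The four regions into which a straight-line drawing of `K₄` divides the plane are
pairwise disjoint. -/
theorem GeneralPosition.opposite_disjoint {a b c d e : Plane} (h : GeneralPosition a b c d e)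
    (h₁ : crossing a b c d = false) (h₂ : crossing a c b d = false)
    (h₃ : crossing a d b c = false) :
    (!(opposite a b c d e && opposite d b c a e) && !(opposite a b c d e && opposite a d c b e) &&
      !(opposite a b c d e && opposite a b d c e) && !(opposite d b c a e && opposite a d c b e) &&
      !(opposite d b c a e && opposite a b d c e) &&
      !(opposite a d c b e && opposite a b d c e)) = true := by
  have hc := h.isChirotope
  unfold opposite insideTri
  unfold crossing at h₁ h₂ h₃
  simp only [ccw_perm h.abc, ccw_perm h.abd, ccw_perm h.acd, ccw_perm h.ace, ccw_perm h.ade,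
    ccw_perm h.bcd, ccw_perm h.bde, ccw_perm h.cde] at *
  generalize ccw a b c = abc at *
  generalize ccw a b d = abd at *
  generalize ccw a b e = abe at *
  generalize ccw a c d = acd at *
  generalize ccw a c e = ace at *
  generalize ccw a d e = ade at *
  generalize ccw b c d = bcd at *
  generalize ccw b c e = bce at *
  generalize ccw b d e = bde at *
  generalize ccw c d e = cde at *
  clear h
  revert abc abd abe acd ace ade bcd bce bde cde
  decide

/-- In a straight-line drawing of `K₅` minus the edge `d e`, the triangle `a b c` separates `d`
from `e`. -/
theorem GeneralPosition.opposite_of_crossing_eq_false {a b c d e : Plane}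
    (h : GeneralPosition a b c d e)
    (h0 : crossing a b c d = false)
    (h1 : crossing a b c e = false)
    (h2 : crossing a c b d = false)
    (h3 : crossing a c b e = false)
    (h4 : crossing a d b c = false)
    (h5 : crossing a d b e = false)
    (h6 : crossing a d c e = false)
    (h7 : crossing a e b c = false)
    (h8 : crossing a e b d = false)
    (h9 : crossing a e c d = false)
    (h10 : crossing b d c e = false)
    (h11 : crossing b e c d = false) :
    opposite a b c d e = true := by
  have hc := h.isChirotope
  unfold opposite insideTri
  unfold crossing at *
  simp only [ccw_perm h.abc, ccw_perm h.abd, ccw_perm h.abe, ccw_perm h.acd, ccw_perm h.ace,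
    ccw_perm h.ade, ccw_perm h.bcd, ccw_perm h.bce, ccw_perm h.bde, ccw_perm h.cde] at *
  generalize ccw a b c = abc at *
  generalize ccw a b d = abd at *
  generalize ccw a b e = abe at *
  generalize ccw a c d = acd at *
  generalize ccw a c e = ace at *
  generalize ccw a d e = ade at *
  generalize ccw b c d = bcd at *
  generalize ccw b c e = bce at *
  generalize ccw b d e = bde at *
  generalize ccw c d e = cde at *
  clear h
  revert abc abd abe acd ace ade bcd bce bde cde
  decide

/-- A face of a stacked triangulation: its three vertices, and a vertex on the other side. -/
abbrev Face := (Fin 3 → ℕ) × ℕ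

/-- The face obtained by replacing the vertex number `k` of `f` by a new vertex `w` inside `f`. -/
def Face.child (f : Face) (w : ℕ) (k : Fin 3) : Face :=
  (Function.update f.1 k w, f.1 k)

/-- The faces of the stacked triangulation with code `c` and vertices `0, …, m + 2`. The vertex
`m + 3` is stacked into the face number `c m`. -/
def faces (c : ℕ → ℕ) : ℕ → ℕ → Face
  | 0, _ => (![0, 1, 2], 0)
  | m + 1, i =>
    if i = c m then (faces c m (c m)).child (m + 3) 0
    else if i = 2 * m + 1 then (faces c m (c m)).child (m + 3) 1
    else if i = 2 * m + 2 then (faces c m (c m)).child (m + 3) 2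
    else faces c m i

/-- `u` is an earlier neighbour of `w`. -/
def BackEdge (c : ℕ → ℕ) (w u : ℕ) : Prop :=
  (w < 3 ∧ u < w) ∨ ∃ m k, w = m + 3 ∧ u = (faces c m (c m)).1 k

/-- Adjacency in the infinite stacked triangulation with code `c`. -/
def StackAdj (c : ℕ → ℕ) (u v : ℕ) : Prop :=
  BackEdge c u v ∨ BackEdge c v u

theorem StackAdj.symm {c : ℕ → ℕ} {u v : ℕ} (h : StackAdj c u v) : StackAdj c v u :=
  Or.symm h

theorem faces_succ_cases (c : ℕ → ℕ) (m i : ℕ) :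
    (∃ k : Fin 3, i = ![c m, 2 * m + 1, 2 * m + 2] k ∧
      faces c (m + 1) i = (faces c m (c m)).child (m + 3) k) ∨
    (i ≠ c m ∧ i ≠ 2 * m + 1 ∧ i ≠ 2 * m + 2 ∧ faces c (m + 1) i = faces c m i) := by
  rw [faces]
  split_ifs with h₀ h₁ h₂
  · exact .inl ⟨0, h₀, rfl⟩
  · exact .inl ⟨1, h₁, rfl⟩
  · exact .inl ⟨2, h₂, rfl⟩
  · exact .inr ⟨h₀, h₁, h₂, rfl⟩

theorem faces_congr {c c' : ℕ → ℕ} {m : ℕ} (h : ∀ j < m, c j = c' j) : faces c m = faces c' m := by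
  induction m with
  | zero => rfl
  | succ m ih =>
    funext i
    rw [faces, faces, ih fun j hj => h j (hj.trans (Nat.lt_succ_self m)), h m (Nat.lt_succ_self m)]

theorem faces_lt (c : ℕ → ℕ) (m i : ℕ) : (∀ k, (faces c m i).1 k < m + 3) ∧
    (faces c m i).2 < m + 3 := by
  induction m generalizing i with
  | zero => exact ⟨fun k => by fin_cases k <;> simp [faces], by simp [faces]⟩
  | succ m ih =>
    rcases faces_succ_cases c m i with ⟨l, -, h⟩ | ⟨-, -, -, h⟩
    · rw [h]
      refine ⟨fun k => ?_, ((ih (c m)).1 l).trans (Nat.lt_succ_self _)⟩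
      simp only [Face.child, Function.update_apply]
      split_ifs
      · omega
      · exact ((ih (c m)).1 k).trans (Nat.lt_succ_self _)
    · rw [h]
      exact ⟨fun k => ((ih i).1 k).trans (Nat.lt_succ_self _),
        (ih i).2.trans (Nat.lt_succ_self _)⟩

theorem BackEdge.lt {c : ℕ → ℕ} {w u : ℕ} (h : BackEdge c w u) : u < w := by
  rcases h with h | ⟨m, k, rfl, rfl⟩
  · exact h.2
  · exact (faces_lt c m (c m)).1 k

theorem StackAdj.ne {c : ℕ → ℕ} {u v : ℕ} (h : StackAdj c u v) : u ≠ v :=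
  h.elim (fun h => h.lt.ne') fun h => h.lt.ne

theorem stackAdj_stack (c : ℕ → ℕ) (m : ℕ) (k : Fin 3) :
    StackAdj c ((faces c m (c m)).1 k) (m + 3) :=
  .inr (.inr ⟨m, k, rfl, rfl⟩)

theorem stackAdj_faces (c : ℕ → ℕ) (m i : ℕ) {k l : Fin 3} (hkl : k ≠ l) :
    StackAdj c ((faces c m i).1 k) ((faces c m i).1 l) := by
  induction m generalizing i k l with
  | zero =>
    unfold StackAdj BackEdge
    fin_cases k <;> fin_cases l <;> simp_all [faces]
  | succ m ih =>
    rcases faces_succ_cases c m i with ⟨j, -, h⟩ | ⟨-, -, -, h⟩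
    · rw [h]
      simp only [Face.child, Function.update_apply]
      split_ifs with h₁ h₂ h₂
      · exact absurd (h₁.trans h₂.symm) hkl
      · exact (stackAdj_stack c m l).symm
      · exact stackAdj_stack c m k
      · exact ih _ hkl
    · rw [h]
      exact ih _ hkl

theorem stackAdj_apex (c : ℕ → ℕ) (hc : ∀ m, c m < 2 * m + 1) (m i : ℕ) (hm : 1 ≤ m)
    (hi : i < 2 * m + 1) (k : Fin 3) : StackAdj c ((faces c m i).1 k) (faces c m i).2 := by
  induction m, hm using Nat.le_induction generalizing i k with
  | base =>
    rcases faces_succ_cases c 0 i with ⟨j, -, h⟩ | ⟨h₀, h₁, h₂, h⟩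
    · rw [h]
      simp only [Face.child, Function.update_apply]
      split_ifs with h₁
      · exact (stackAdj_stack c 0 j).symm
      · exact stackAdj_faces c 0 _ h₁
    · have := hc 0
      omega
  | succ m hm ih =>
    rcases faces_succ_cases c m i with ⟨j, -, h⟩ | ⟨h₀, h₁, h₂, h⟩
    · rw [h]
      simp only [Face.child, Function.update_apply]
      split_ifs with h₁
      · exact (stackAdj_stack c m j).symm
      · exact stackAdj_faces c m _ h₁
    · rw [h]
      exact ih i (by omega) k

/-- Every triple of points of `q` with indices below `n` is in general position. -/
def IsGeneric (n : ℕ) (q : ℕ → Plane) : Prop :=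
  ∀ i j k, i < n → j < n → k < n → i ≠ j → i ≠ k → j ≠ k → orient (q i) (q j) (q k) ≠ 0

/-- No two vertex-disjoint edges on vertices below `n` cross. -/
def CrossingFree (c : ℕ → ℕ) (n : ℕ) (q : ℕ → Plane) : Prop :=
  ∀ u v x y, u < n → v < n → x < n → y < n → StackAdj c u v → StackAdj c x y →
    u ≠ x → u ≠ y → v ≠ x → v ≠ y → crossing (q u) (q v) (q x) (q y) = false

theorem IsGeneric.generalPosition {n : ℕ} {q : ℕ → Plane} (hq : IsGeneric n q) {a b c d e : ℕ}
    (ha : a < n) (hb : b < n) (hc : c < n) (hd : d < n) (he : e < n) (hab : a ≠ b) (hac : a ≠ c)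
    (had : a ≠ d) (hae : a ≠ e) (hbc : b ≠ c) (hbd : b ≠ d) (hbe : b ≠ e) (hcd : c ≠ d)
    (hce : c ≠ e) (hde : d ≠ e) : GeneralPosition (q a) (q b) (q c) (q d) (q e) := by
  constructor <;> apply hq <;> assumption

/-- The point `x` lies in the region of the face `f`. -/
def Face.region (q : ℕ → Plane) (f : Face) (x : ℕ) : Bool :=
  opposite (q (f.1 0)) (q (f.1 1)) (q (f.1 2)) (q f.2) (q x)

theorem not_region_child_and_region_child {c : ℕ → ℕ} {n : ℕ} {q : ℕ → Plane} (hq : IsGeneric n q)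
    (h : CrossingFree c n q) {m x : ℕ} (hmx : m + 3 < x) (hx : x < n) :
    (∀ k l : Fin 3, k ≠ l → ¬ (((faces c m (c m)).child (m + 3) k).region q x = true ∧
      ((faces c m (c m)).child (m + 3) l).region q x = true)) ∧
    (∀ k : Fin 3, ¬ (((faces c m (c m)).child (m + 3) k).region q x = true ∧
      Face.region q ((faces c m (c m)).1, m + 3) x = true)) := by
  have h0 := (faces_lt c m (c m)).1 0
  have h1 := (faces_lt c m (c m)).1 1
  have h2 := (faces_lt c m (c m)).1 2
  have h01 := stackAdj_faces c m (c m) (k := 0) (l := 1) (by decide)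
  have h02 := stackAdj_faces c m (c m) (k := 0) (l := 2) (by decide)
  have h12 := stackAdj_faces c m (c m) (k := 1) (l := 2) (by decide)
  have h0w := stackAdj_stack c m 0
  have h1w := stackAdj_stack c m 1
  have h2w := stackAdj_stack c m 2
  have hg := hq.generalPosition (a := (faces c m (c m)).1 0) (b := (faces c m (c m)).1 1)
    (c := (faces c m (c m)).1 2) (d := m + 3) (e := x) (by omega) (by omega) (by omega) (by omega)
    hx h01.ne h02.ne h0.ne (by omega) h12.ne h1.ne (by omega) h2.ne (by omega) hmx.ne
  have key := hg.opposite_disjoint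
    (h _ _ _ _ (by omega) (by omega) (by omega) (by omega) h01 h2w h02.ne h0.ne h12.ne h1.ne)
    (h _ _ _ _ (by omega) (by omega) (by omega) (by omega) h02 h1w h01.ne h0.ne h12.symm.ne h2.ne)
    (h _ _ _ _ (by omega) (by omega) (by omega) (by omega) h0w h12 h01.ne h02.ne h1.ne' h2.ne')
  simp only [Bool.and_eq_true, Bool.not_eq_true', Bool.and_eq_false_iff] at key
  constructor
  · intro k l hkl
    fin_cases k <;> fin_cases l <;> simp [Face.region, Face.child] at hkl ⊢ <;> grind
  · intro k
    fin_cases k <;> simp [Face.region, Face.child] <;> grind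

/-- The vertex `m + 3` lies in the region of the face into which it is stacked. -/
theorem region_stack {c : ℕ → ℕ} (hc : ∀ m, c m < 2 * m + 1) {n : ℕ} {q : ℕ → Plane}
    (hq : IsGeneric n q) (h : CrossingFree c n q) {m : ℕ} (hm : 1 ≤ m) (hmn : m + 3 < n) :
    (faces c m (c m)).region q (m + 3) = true := by
  have h0 := (faces_lt c m (c m)).1 0
  have h1 := (faces_lt c m (c m)).1 1
  have h2 := (faces_lt c m (c m)).1 2
  have hd := (faces_lt c m (c m)).2
  have h01 := stackAdj_faces c m (c m) (k := 0) (l := 1) (by decide)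
  have h02 := stackAdj_faces c m (c m) (k := 0) (l := 2) (by decide)
  have h12 := stackAdj_faces c m (c m) (k := 1) (l := 2) (by decide)
  have h0d := stackAdj_apex c hc m (c m) hm (hc m) 0
  have h1d := stackAdj_apex c hc m (c m) hm (hc m) 1
  have h2d := stackAdj_apex c hc m (c m) hm (hc m) 2
  have h0w := stackAdj_stack c m 0
  have h1w := stackAdj_stack c m 1
  have h2w := stackAdj_stack c m 2
  have hg := hq.generalPosition (a := (faces c m (c m)).1 0) (b := (faces c m (c m)).1 1)
    (c := (faces c m (c m)).1 2) (d := (faces c m (c m)).2) (e := m + 3) (by omega) (by omega)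
    (by omega) (by omega) hmn h01.ne h02.ne h0d.ne h0.ne h12.ne h1d.ne h1.ne h2d.ne h2.ne hd.ne
  have n01 := h01.ne
  have n02 := h02.ne
  have n12 := h12.ne
  have n0d := h0d.ne
  have n1d := h1d.ne
  have n2d := h2d.ne
  apply hg.opposite_of_crossing_eq_false <;> apply h <;> first | assumption | omega

theorem not_region_and_region {c : ℕ → ℕ} (hc : ∀ m, c m < 2 * m + 1) {n : ℕ} {q : ℕ → Plane}
    (hq : IsGeneric n q) (h : CrossingFree c n q) {m x i j : ℕ} (hmx : m + 3 ≤ x) (hx : x < n)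
    (hi : i < 2 * m + 1) (hj : j < 2 * m + 1) (hij : i ≠ j) :
    ¬ ((faces c m i).region q x = true ∧ (faces c m j).region q x = true) := by
  induction m generalizing i j with
  | zero => omega
  | succ m ih =>
    obtain ⟨hcc, hcp⟩ := not_region_child_and_region_child hq h (m := m) (by omega) hx
    have hpar : 1 ≤ m → ∀ k, ((faces c m (c m)).child (m + 3) k).region q x = true →
        (faces c m (c m)).region q x = true := by
      intro hm k hk
      have h1 := hcp k
      have h2 := region_stack hc hq h hm (by omega)
      rw [hk] at h1
      simp only [Face.region, opposite] at h1 h2 ⊢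
      grind
    have hpos : ∀ i, i ≠ c m → i < 2 * m + 1 → 1 ≤ m := by
      intro i h1 h2
      have := hc m
      omega
    have := hc m
    rcases faces_succ_cases c m i with ⟨k, hk, e⟩ | ⟨h₀, h₁, h₂, e⟩ <;>
    rcases faces_succ_cases c m j with ⟨l, hl, e'⟩ | ⟨h₀', h₁', h₂', e'⟩ <;> rw [e, e']
    · refine hcc k l ?_
      rintro rfl
      exact hij (hk.trans hl.symm)
    · rintro ⟨hk', hj'⟩
      exact ih (by omega) this (by omega) h₀'.symm
        ⟨hpar (hpos j h₀' (by omega)) k hk', hj'⟩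
    · rintro ⟨hi', hl'⟩
      exact ih (by omega) (by omega) this h₀ ⟨hi', hpar (hpos i h₀ (by omega)) l hl'⟩
    · exact ih (by omega) (by omega) (by omega) hij

/-- A generic point configuration determines the code of a crossing-free stacked triangulation. -/
theorem CrossingFree.code_eq {c c' : ℕ → ℕ} (hc : ∀ m, c m < 2 * m + 1)
    (hc' : ∀ m, c' m < 2 * m + 1) {n : ℕ} {q : ℕ → Plane} (hq : IsGeneric n q)
    (h : CrossingFree c n q) (h' : CrossingFree c' n q) (m : ℕ) (hm : m + 3 < n) :
    c m = c' m := by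
  induction m using Nat.strong_induction_on with
  | _ m ih =>
    have hf := faces_congr fun j hj => ih j hj (by omega)
    by_contra hne
    have h1 := hc m
    have h2 := hc' m
    have hm1 : 1 ≤ m := by omega
    refine not_region_and_region hc hq h le_rfl hm h1 h2 hne ⟨region_stack hc hq h hm1 hm, ?_⟩
    rw [hf]
    exact region_stack hc' hq h' hm1 hm

/-- The combination of the points `π (v k)` with weights `β k`. -/
def comb (π : ℕ → Plane) (v : Fin 3 → ℕ) (β : Fin 3 → ℝ) : Plane :=
  ∑ k, β k • π (v k)

/-- `π` is a straight-line drawing of the stacked triangulation with code `c` on the vertices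
below `m + 3`, all of whose bounded faces are nondegenerate empty triangles. -/
structure IsDrawing (c : ℕ → ℕ) (m : ℕ) (π : ℕ → Plane) : Prop where
  inj : ∀ u v, u < m + 3 → v < m + 3 → π u = π v → u = v
  edges : ∀ a b x y p, BackEdge c a b → BackEdge c x y → a < m + 3 → x < m + 3 →
    (a ≠ x ∨ b ≠ y) → p ∈ segment ℝ (π a) (π b) → p ∈ segment ℝ (π x) (π y) →
    ∃ z, (z = a ∨ z = b) ∧ (z = x ∨ z = y) ∧ p = π z
  indep : ∀ i < 2 * m + 1, ∀ β : Fin 3 → ℝ, ∑ k, β k = 0 → comb π (faces c m i).1 β = 0 → β = 0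
  avoid : ∀ i < 2 * m + 1, ∀ a b, BackEdge c a b → a < m + 3 → ∀ β : Fin 3 → ℝ, (∀ k, 0 < β k) →
    ∑ k, β k = 1 → comb π (faces c m i).1 β ∉ segment ℝ (π a) (π b)
  disj : ∀ i < 2 * m + 1, ∀ j < 2 * m + 1, i ≠ j → ∀ β γ : Fin 3 → ℝ, (∀ k, 0 < β k) →
    (∀ k, 0 < γ k) → ∑ k, β k = 1 → ∑ k, γ k = 1 →
    comb π (faces c m i).1 β ≠ comb π (faces c m j).1 γ

theorem exists_neighbour (c : ℕ → ℕ) (m u : ℕ) (hu : u < m + 3) :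
    ∃ a b, BackEdge c a b ∧ a < m + 3 ∧ (u = a ∨ u = b) := by
  rcases lt_or_ge u 3 with h | h
  · rcases Nat.eq_zero_or_pos u with rfl | h'
    · exact ⟨1, 0, .inl (by omega), by omega, .inr rfl⟩
    · exact ⟨u, 0, .inl (by omega), hu, .inl rfl⟩
  · obtain ⟨k, rfl⟩ := Nat.exists_eq_add_of_le' h
    exact ⟨k + 3, _, .inr ⟨k, 0, rfl, rfl⟩, hu, .inl rfl⟩

theorem IsDrawing.eq_or_eq_of_mem_segment {c : ℕ → ℕ} {m : ℕ} {π : ℕ → Plane}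
    (h : IsDrawing c m π) {u x y : ℕ} (hu : u < m + 3) (hx : x < m + 3) (hxy : BackEdge c x y)
    (hmem : π u ∈ segment ℝ (π x) (π y)) : u = x ∨ u = y := by
  obtain ⟨a, b, hab, ha, hua⟩ := exists_neighbour c m u hu
  by_cases hne : a ≠ x ∨ b ≠ y
  · have hmem' : π u ∈ segment ℝ (π a) (π b) := by
      rcases hua with rfl | rfl
      · exact left_mem_segment ℝ _ _
      · exact right_mem_segment ℝ _ _
    obtain ⟨z, -, hz, hz'⟩ := h.edges a b x y _ hab hxy ha hx hne hmem' hmem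
    have hzm : z < m + 3 := by
      have := hxy.lt
      omega
    rwa [h.inj u z hu hzm hz']
  · push Not at hne
    rwa [← hne.1, ← hne.2]

theorem isDrawing_zero (c : ℕ → ℕ) :
    IsDrawing c 0 fun u => if u = 0 then !₂[0, 0] else if u = 1 then !₂[1, 0] else !₂[0, 1] := by
  have hback : ∀ a b, BackEdge c a b → a < 0 + 3 → (a = 1 ∧ b = 0) ∨ (a = 2 ∧ b = 0) ∨
      (a = 2 ∧ b = 1) := by
    rintro a b (h | ⟨m, k, rfl, rfl⟩) ha
    · omega
    · omega
  constructor
  · intro u v hu hv h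
    have h0 := congrArg (fun p : Plane => p 0) h
    have h1 := congrArg (fun p : Plane => p 1) h
    interval_cases u <;> interval_cases v <;> simp at h0 h1 ⊢
  · rintro a b x y p hab hxy ha hx hne ⟨s, t, hs, ht, hst, hp⟩ ⟨s', t', hs', ht', hst', hp'⟩
    have h0 := congrArg (fun p : Plane => p 0) (hp.trans hp'.symm)
    have h1 := congrArg (fun p : Plane => p 1) (hp.trans hp'.symm)
    have hp0 := congrArg (fun p : Plane => p 0) hp
    have hp1 := congrArg (fun p : Plane => p 1) hp
    have ext : ∀ q : Plane, p 0 = q 0 → p 1 = q 1 → p = q := by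
      intro q h0 h1
      ext i
      fin_cases i <;> assumption
    rcases hback a b hab ha with ⟨rfl, rfl⟩ | ⟨rfl, rfl⟩ | ⟨rfl, rfl⟩ <;>
    rcases hback x y hxy hx with ⟨rfl, rfl⟩ | ⟨rfl, rfl⟩ | ⟨rfl, rfl⟩ <;>
    simp at hne h0 h1 hp0 hp1
    · exact ⟨0, .inr rfl, .inr rfl, ext _ (by simp; linarith) (by simp; linarith)⟩
    · exact ⟨1, .inl rfl, .inr rfl, ext _ (by simp; linarith) (by simp; linarith)⟩
    · exact ⟨0, .inr rfl, .inr rfl, ext _ (by simp; linarith) (by simp; linarith)⟩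
    · exact ⟨2, .inl rfl, .inl rfl, ext _ (by simp; linarith) (by simp; linarith)⟩
    · exact ⟨1, .inr rfl, .inl rfl, ext _ (by simp; linarith) (by simp; linarith)⟩
    · exact ⟨2, .inl rfl, .inl rfl, ext _ (by simp; linarith) (by simp; linarith)⟩
  · intro i _ β hβ h
    have h0 := congrArg (fun p : Plane => p 0) h
    have h1 := congrArg (fun p : Plane => p 1) h
    simp [comb, faces, Fin.sum_univ_three] at h0 h1 hβ
    funext k
    fin_cases k <;> simp <;> linarith
  · rintro i _ a b hab ha β hβ hβ1 ⟨s, t, hs, ht, hst, hp⟩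
    have h0 := congrArg (fun p : Plane => p 0) hp
    have h1 := congrArg (fun p : Plane => p 1) hp
    have := hβ 0
    have := hβ 1
    have := hβ 2
    rcases hback a b hab ha with ⟨rfl, rfl⟩ | ⟨rfl, rfl⟩ | ⟨rfl, rfl⟩ <;>
    simp [comb, faces, Fin.sum_univ_three] at h0 h1 hβ1 <;> linarith
  · intro i hi j hj hij
    omega

/-- Barycentric coordinates in a face of a point with coordinates `β` in its child number `k`. -/
def childWeights (k : Fin 3) (β : Fin 3 → ℝ) (j : Fin 3) : ℝ :=
  (if j = k then 0 else β j) + β k / 3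

theorem sum_childWeights (k : Fin 3) (β : Fin 3 → ℝ) : ∑ j, childWeights k β j = ∑ j, β j := by
  fin_cases k <;> simp [childWeights, Fin.sum_univ_three] <;> ring

theorem childWeights_pos {k : Fin 3} {β : Fin 3 → ℝ} (hβ : ∀ j, 0 < β j) (j : Fin 3) :
    0 < childWeights k β j := by
  have h1 := hβ j
  have h2 := hβ k
  unfold childWeights
  split_ifs <;> linarith

theorem childWeights_lt {k : Fin 3} {β : Fin 3 → ℝ} (hβ : ∀ j, 0 < β j) {j : Fin 3} (hj : j ≠ k) :
    childWeights k β k < childWeights k β j := by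
  have h1 := hβ j
  unfold childWeights
  rw [if_pos rfl, if_neg hj]
  linarith

/-- Place a new vertex `w` at the centroid of the triangle `v`. -/
def stackPoint (π : ℕ → Plane) (v : Fin 3 → ℕ) (w : ℕ) : ℕ → Plane :=
  Function.update π w (comb π v fun _ => 1 / 3)

theorem comb_stackPoint {π : ℕ → Plane} {v u : Fin 3 → ℕ} {w : ℕ} (hu : ∀ k, u k ≠ w)
    (β : Fin 3 → ℝ) : comb (stackPoint π v w) u β = comb π u β := by
  simp [comb, stackPoint, Function.update_of_ne (hu _)]

theorem comb_update {π : ℕ → Plane} {v : Fin 3 → ℕ} {w : ℕ} (hv : ∀ k, v k ≠ w) (k : Fin 3)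
    (β : Fin 3 → ℝ) : comb (stackPoint π v w) (Function.update v k w) β =
      comb π v (childWeights k β) := by
  unfold comb stackPoint childWeights
  fin_cases k <;>
  simp [Fin.sum_univ_three, Function.update_of_ne (hv _), comb] <;> module

theorem comb_spoke {π : ℕ → Plane} {v : Fin 3 → ℕ} {w : ℕ} (hv : ∀ k, v k ≠ w) (k : Fin 3)
    (s t : ℝ) : s • stackPoint π v w w + t • stackPoint π v w (v k) =
      comb π v fun j => s / 3 + if j = k then t else 0 := by
  unfold stackPoint
  rw [Function.update_self, Function.update_of_ne (hv k)]
  unfold comb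
  fin_cases k <;> simp [Fin.sum_univ_three] <;> module

theorem comb_single (π : ℕ → Plane) (v : Fin 3 → ℕ) (k : Fin 3) :
    (comb π v fun j => 0 / 3 + if j = k then 1 else 0) = π (v k) := by
  simp [comb]

theorem IsDrawing.weights_eq {c : ℕ → ℕ} {m : ℕ} {π : ℕ → Plane} (h : IsDrawing c m π) {i : ℕ}
    (hi : i < 2 * m + 1) {β γ : Fin 3 → ℝ} (hβγ : ∑ k, β k = ∑ k, γ k)
    (he : comb π (faces c m i).1 β = comb π (faces c m i).1 γ) : β = γ := by
  have := h.indep i hi (β - γ) (by simp [hβγ]) (by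
    rw [← sub_eq_zero] at he
    rw [← he]
    simp [comb, sub_smul, Finset.sum_sub_distrib])
  exact sub_eq_zero.1 this

theorem IsDrawing.stack {c : ℕ → ℕ} {m : ℕ} {π : ℕ → Plane} (hc : ∀ m, c m < 2 * m + 1)
    (h : IsDrawing c m π) :
    IsDrawing c (m + 1) (stackPoint π (faces c m (c m)).1 (m + 3)) := by
  set v := (faces c m (c m)).1 with hv
  set π' := stackPoint π v (m + 3) with hπ'
  have hvlt : ∀ k, v k < m + 3 := (faces_lt c m (c m)).1
  have hvne : ∀ k, v k ≠ m + 3 := fun k => (hvlt k).ne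
  have hold : ∀ u, u < m + 3 → π' u = π u := fun u hu => Function.update_of_ne hu.ne _ _
  have hcomb : ∀ i β, comb π' (faces c m i).1 β = comb π (faces c m i).1 β := fun i β =>
    comb_stackPoint (fun k => ((faces_lt c m i).1 k).ne) β
  have hchild : ∀ k β, comb π' ((faces c m (c m)).child (m + 3) k).1 β =
      comb π v (childWeights k β) := fun k β => comb_update hvne k β
  have hback : ∀ a b, BackEdge c a b → a < m + 1 + 3 →
      (a < m + 3 ∧ b < m + 3) ∨ (a = m + 3 ∧ ∃ k, b = v k) := by
    intro a b hab ha
    have hlt := hab.lt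
    rcases lt_or_ge a (m + 3) with h' | h'
    · exact .inl ⟨h', by omega⟩
    · obtain rfl : a = m + 3 := by omega
      rcases hab with h'' | ⟨m', k, hm, hb⟩
      · omega
      · obtain rfl : m = m' := by omega
        exact .inr ⟨rfl, k, hb⟩
  -- a point of a new edge is an old vertex or lies in the open face
  have hspoke : ∀ k p, p ∈ segment ℝ (π' (m + 3)) (π' (v k)) →
      ∃ s t : ℝ, 0 ≤ s ∧ 0 ≤ t ∧ s + t = 1 ∧
        p = comb π v (fun j => s / 3 + if j = k then t else 0) := by
    rintro k p ⟨s, t, hs, ht, hst, rfl⟩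
    exact ⟨s, t, hs, ht, hst, comb_spoke hvne k s t⟩
  have hsum : ∀ (k : Fin 3) (s t : ℝ), s + t = 1 →
      ∑ j, (s / 3 + if j = k then t else 0) = 1 := by
    intro k s t hst
    rw [Finset.sum_add_distrib, Finset.sum_ite_eq', if_pos (Finset.mem_univ k)]
    simp only [Finset.sum_const, Finset.card_univ, Fintype.card_fin, nsmul_eq_mul]
    push_cast
    linarith
  have hopen : ∀ k p, p ∈ segment ℝ (π' (m + 3)) (π' (v k)) → p = π (v k) ∨
      ∃ β : Fin 3 → ℝ, (∀ j, 0 < β j) ∧ ∑ j, β j = 1 ∧ p = comb π v β := by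
    intro k p hp
    obtain ⟨s, t, hs, ht, hst, rfl⟩ := hspoke k p hp
    rcases hs.eq_or_lt with rfl | hs
    · obtain rfl : t = 1 := by linarith
      exact .inl (comb_single π v k)
    · refine .inr ⟨_, fun j => ?_, hsum k s t hst, rfl⟩
      split_ifs <;> positivity
  have hmix : ∀ k x y p, BackEdge c x y → x < m + 3 → y < m + 3 →
      p ∈ segment ℝ (π' (m + 3)) (π' (v k)) → p ∈ segment ℝ (π' x) (π' y) →
      (v k = x ∨ v k = y) ∧ p = π' (v k) := by
    intro k x y p hxy hx hy hp hp'
    rw [hold x hx, hold y hy] at hp'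
    rcases hopen k p hp with rfl | ⟨β, hβ, hβ1, rfl⟩
    · exact ⟨h.eq_or_eq_of_mem_segment (hvlt k) hx hxy hp', (hold _ (hvlt k)).symm⟩
    · exact absurd hp' (h.avoid (c m) (hc m) x y hxy hx β hβ hβ1)
  have hthird : ∀ k l : Fin 3, ∃ j, j ≠ k ∧ j ≠ l := by decide
  have hnew : ∀ u < m + 3, π' (m + 3) ≠ π' u := by
    intro u hu he
    obtain ⟨a, b, hab, ha, hua⟩ := exists_neighbour c m u hu
    have hmem : π' (m + 3) ∈ segment ℝ (π a) (π b) := by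
      rw [he, hold u hu]
      rcases hua with rfl | rfl
      · exact left_mem_segment ℝ _ _
      · exact right_mem_segment ℝ _ _
    refine h.avoid (c m) (hc m) a b hab ha (fun _ => 1 / 3) (fun _ => by norm_num)
      (by norm_num) ?_
    rwa [hπ', stackPoint, Function.update_self] at hmem
  have hslot := hc m
  constructor
  · intro u u' hu hu' he
    rcases lt_or_ge u (m + 3) with h1 | h1 <;> rcases lt_or_ge u' (m + 3) with h2 | h2
    · exact h.inj u u' h1 h2 (by rwa [hold u h1, hold u' h2] at he)
    · obtain rfl : u' = m + 3 := by omega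
      exact absurd he.symm (hnew u h1)
    · obtain rfl : u = m + 3 := by omega
      exact absurd he (hnew u' h2)
    · omega
  · intro a b x y p hab hxy ha hx hne hp hp'
    rcases hback a b hab ha with ⟨ha', hb'⟩ | ⟨rfl, k, rfl⟩ <;>
    rcases hback x y hxy hx with ⟨hx', hy'⟩ | ⟨rfl, l, rfl⟩
    · rw [hold a ha', hold b hb'] at hp
      rw [hold x hx', hold y hy'] at hp'
      obtain ⟨z, hz, hz', rfl⟩ := h.edges a b x y p hab hxy ha' hx' hne hp hp'
      exact ⟨z, hz, hz', (hold z (by omega)).symm⟩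
    · obtain ⟨h1, h2⟩ := hmix l a b p hab ha' hb' hp' hp
      exact ⟨_, h1, .inr rfl, h2⟩
    · obtain ⟨h1, h2⟩ := hmix k x y p hxy hx' hy' hp hp'
      exact ⟨_, .inr rfl, h1, h2⟩
    · have hkl : k ≠ l := by
        rintro rfl
        simp at hne
      refine ⟨m + 3, .inl rfl, .inl rfl, ?_⟩
      obtain ⟨s, t, hs, ht, hst, hps⟩ := hspoke k p hp
      obtain ⟨s', t', hs', ht', hst', hps'⟩ := hspoke l p hp'
      have hw := h.weights_eq (hc m) ((hsum k s t hst).trans (hsum l s' t' hst').symm)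
        (hps.symm.trans hps')
      have h1 := congrFun hw k
      have h2 := congrFun hw l
      simp only [if_true, if_neg hkl, if_neg hkl.symm] at h1 h2
      obtain rfl : t = 0 := by linarith
      obtain rfl : s = 1 := by linarith
      rw [hps, ← comb_spoke hvne k 1 0]
      simp [hπ']
  · intro i hi β hβ hβ0
    rcases faces_succ_cases c m i with ⟨k, hk, e⟩ | ⟨h₀, h₁, h₂, e⟩
    · rw [e, hchild] at hβ0
      have hz := h.indep (c m) (hc m) _ ((sum_childWeights k β).trans hβ) hβ0
      have hk0 := congrFun hz k
      simp only [childWeights, if_true, Pi.zero_apply] at hk0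
      funext j
      have hj := congrFun hz j
      simp only [childWeights, Pi.zero_apply] at hj ⊢
      split_ifs at hj with hjk
      · subst hjk
        linarith
      · linarith
    · rw [e, hcomb] at hβ0
      exact h.indep i (by omega) β hβ hβ0
  · intro i hi a b hab ha β hβ hβ1 hp
    rcases faces_succ_cases c m i with ⟨k, hk, e⟩ | ⟨h₀, h₁, h₂, e⟩ <;>
    rcases hback a b hab ha with ⟨ha', hb'⟩ | ⟨rfl, l, rfl⟩
    · rw [e, hchild, hold a ha', hold b hb'] at hp
      exact h.avoid (c m) (hc m) a b hab ha' _ (childWeights_pos hβ)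
        ((sum_childWeights k β).trans hβ1) hp
    · rw [e, hchild] at hp
      obtain ⟨s, t, hs, ht, hst, hps⟩ := hspoke l _ hp
      have hw := h.weights_eq (hc m)
        (((sum_childWeights k β).trans hβ1).trans (hsum l s t hst).symm) hps
      obtain ⟨j, hjk, hjl⟩ := hthird k l
      have hlt := childWeights_lt hβ hjk
      rw [hw] at hlt
      simp only [if_neg hjl] at hlt
      split_ifs at hlt <;> linarith
    · rw [e, hcomb, hold a ha', hold b hb'] at hp
      exact h.avoid i (by omega) a b hab ha' β hβ hβ1 hp
    · rw [e, hcomb] at hp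
      rcases hopen l _ hp with hp | ⟨γ, hγ, hγ1, hp⟩
      · obtain ⟨x, y, hxy, hx, hux⟩ := exists_neighbour c m (v l) (hvlt l)
        refine h.avoid i (by omega) x y hxy hx β hβ hβ1 ?_
        rw [hp]
        rcases hux with hux | hux <;> rw [hux]
        · exact left_mem_segment ℝ _ _
        · exact right_mem_segment ℝ _ _
      · exact h.disj i (by omega) (c m) (hc m) h₀ β γ hβ hγ hβ1 hγ1 hp
  · intro i hi j hj hij β γ hβ hγ hβ1 hγ1
    rcases faces_succ_cases c m i with ⟨k, hk, e⟩ | ⟨h₀, h₁, h₂, e⟩ <;>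
    rcases faces_succ_cases c m j with ⟨l, hl, e'⟩ | ⟨h₀', h₁', h₂', e'⟩ <;>
    rw [e, e'] <;> simp only [hchild, hcomb]
    · have hkl : k ≠ l := by
        rintro rfl
        exact hij (hk.trans hl.symm)
      intro he
      have hw := h.weights_eq (hc m) (((sum_childWeights k β).trans hβ1).trans
        ((sum_childWeights l γ).trans hγ1).symm) he
      have h1 := childWeights_lt hβ hkl.symm
      have h2 := childWeights_lt hγ hkl
      rw [hw] at h1
      exact lt_asymm h1 h2
    · exact h.disj (c m) (hc m) j (by omega) h₀'.symm _ _ (childWeights_pos hβ) hγ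
        ((sum_childWeights k β).trans hβ1) hγ1
    · exact h.disj i (by omega) (c m) (hc m) h₀ _ _ hβ (childWeights_pos hγ) hβ1
        ((sum_childWeights l γ).trans hγ1)
    · exact h.disj i (by omega) j (by omega) hij _ _ hβ hγ hβ1 hγ1

theorem exists_isDrawing {c : ℕ → ℕ} (hc : ∀ m, c m < 2 * m + 1) (m : ℕ) :
    ∃ π, IsDrawing c m π := by
  induction m with
  | zero => exact ⟨_, isDrawing_zero c⟩
  | succ m ih =>
    obtain ⟨π, h⟩ := ih
    exact ⟨_, h.stack hc⟩

/-- The stacked triangulation with code `c` on the vertex set `Fin n`. -/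
def stackGraph (c : ℕ → ℕ) (n : ℕ) : SimpleGraph (Fin n) where
  Adj u v := StackAdj c u v
  symm := ⟨fun _ _ h => h.symm⟩
  loopless := ⟨fun _ h => h.ne rfl⟩

theorem planarEmbeddable_stackGraph {c : ℕ → ℕ} (hc : ∀ m, c m < 2 * m + 1) (m : ℕ) :
    PlanarEmbeddable (stackGraph c (m + 3)) := by
  obtain ⟨π, h⟩ := exists_isDrawing hc m
  have horient : ∀ u v : Fin (m + 3), (stackGraph c (m + 3)).Adj u v →
      ∃ a b : Fin (m + 3), BackEdge c a b ∧ segment ℝ (π u) (π v) = segment ℝ (π a) (π b) ∧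
        s(u, v) = s(a, b) := by
    rintro u v (h' | h')
    · exact ⟨u, v, h', rfl, rfl⟩
    · exact ⟨v, u, h', segment_symm ℝ _ _, Sym2.eq_swap⟩
  have hset : ∀ u v a b z : Fin (m + 3), s(u, v) = s(a, b) → z = a ∨ z = b →
      z ∈ ({u, v} : Set (Fin (m + 3))) := by
    intro u v a b z he hz
    rw [← Sym2.mem_iff, ← he, Sym2.mem_iff] at hz
    simpa using hz
  refine ⟨fun u => π u, fun u v huv => Fin.ext (h.inj u v u.2 v.2 huv), ?_, ?_⟩
  · rintro u v x y huv hxy hne p ⟨hp, hp'⟩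
    obtain ⟨a, b, hab, hseg, he⟩ := horient u v huv
    obtain ⟨a', b', hab', hseg', he'⟩ := horient x y hxy
    dsimp only at hp hp'
    rw [hseg] at hp
    rw [hseg'] at hp'
    rw [he, he'] at hne
    obtain ⟨z, hz, hz', rfl⟩ := h.edges a b a' b' p hab hab' a.2 a'.2 (by
      by_contra! hcon
      exact hne (by rw [Fin.ext hcon.1, Fin.ext hcon.2])) hp hp'
    have hzm : z < m + 3 := by
      have := a.2
      have := b.2
      omega
    refine ⟨⟨z, hzm⟩, ⟨hset _ _ _ _ _ he ?_, hset _ _ _ _ _ he' ?_⟩, rfl⟩ <;>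
    simpa [Fin.ext_iff]
  · intro u v w huv hwu hwv hmem
    obtain ⟨a, b, hab, hseg, he⟩ := horient u v huv
    have hmem' := openSegment_subset_segment ℝ _ _ hmem
    dsimp only at hmem'
    rw [hseg] at hmem'
    have := hset u v a b w he (by
      simpa [Fin.ext_iff] using h.eq_or_eq_of_mem_segment w.2 a.2 hab hmem')
    simp [hwu, hwv] at this

section

open Filter Topology

/-- Points separated by a line have non-crossing segments. -/
theorem crossing_eq_false_of_separated {u v x y : Plane} {α β s : ℝ} (huvx : orient u v x ≠ 0)
    (huvy : orient u v y ≠ 0) (hxyu : orient x y u ≠ 0) (hxyv : orient x y v ≠ 0)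
    (hu : α * u 0 + β * u 1 < s) (hv : α * v 0 + β * v 1 < s) (hx : s < α * x 0 + β * x 1)
    (hy : s < α * y 0 + β * y 1) : crossing u v x y = false := by
  by_contra hcon
  rw [Bool.not_eq_false, crossing, Bool.and_eq_true, bne_iff_ne, bne_iff_ne] at hcon
  obtain ⟨h₁, h₂⟩ := hcon
  have hsum : orient x y v - orient x y u + orient u v y - orient u v x = 0 := by
    unfold orient; ring
  have hrel : orient x y v * (α * u 0 + β * u 1) - orient x y u * (α * v 0 + β * v 1) +
      orient u v y * (α * x 0 + β * x 1) - orient u v x * (α * y 0 + β * y 1) = 0 := by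
    unfold orient; ring
  generalize α * u 0 + β * u 1 = U at *
  generalize α * v 0 + β * v 1 = V at *
  generalize α * x 0 + β * x 1 = X at *
  generalize α * y 0 + β * y 1 = Y at *
  unfold ccw at h₁ h₂
  generalize orient x y v = a at *
  generalize orient x y u = b at *
  generalize orient u v y = c at *
  generalize orient u v x = d at *
  have hrel' : a * (s - U) - b * (s - V) + c * (s - X) - d * (s - Y) = 0 := by
    linear_combination s * hsum - hrel
  rcases lt_or_gt_of_ne huvx with h3 | h3 <;> rcases lt_or_gt_of_ne huvy with h4 | h4 <;>
  rcases lt_or_gt_of_ne hxyu with h5 | h5 <;> rcases lt_or_gt_of_ne hxyv with h6 | h6 <;>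
  simp [h3, h4, h5, h6, h3.not_gt, h4.not_gt, h5.not_gt, h6.not_gt] at h₁ h₂ <;>
  first
  | linarith
  | nlinarith [mul_pos h6 (sub_pos.2 hu), mul_neg_of_neg_of_pos h5 (sub_pos.2 hv),
      mul_neg_of_neg_of_pos h4 (sub_pos.2 hx), mul_pos h3 (sub_pos.2 hy)]
  | nlinarith [mul_neg_of_neg_of_pos h6 (sub_pos.2 hu), mul_pos h5 (sub_pos.2 hv),
      mul_neg_of_neg_of_pos h3 (sub_pos.2 hy), mul_pos h4 (sub_pos.2 hx)]

theorem exists_separating_line {u v x y : Plane}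
    (h : Disjoint (segment ℝ u v) (segment ℝ x y)) : ∃ α β s : ℝ, α * u 0 + β * u 1 < s ∧
      α * v 0 + β * v 1 < s ∧ s < α * x 0 + β * x 1 ∧ s < α * y 0 + β * y 1 := by
  have hcomp : ∀ a b : Plane, IsCompact (segment ℝ a b) := fun a b => by
    rw [← convexHull_pair]
    exact (Set.toFinite {a, b}).isCompact_convexHull ℝ
  obtain ⟨f, s, t, hs, hst, ht⟩ := geometric_hahn_banach_compact_closed (convex_segment u v)
    (hcomp u v) (convex_segment x y) (hcomp x y).isClosed h
  have hf : ∀ p : Plane, f p = f !₂[1, 0] * p 0 + f !₂[0, 1] * p 1 := by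
    intro p
    have hp : p = p 0 • !₂[1, 0] + p 1 • !₂[0, 1] := by
      ext i
      fin_cases i <;> simp
    conv_lhs => rw [hp, map_add, map_smul, map_smul, smul_eq_mul, smul_eq_mul]
    ring
  refine ⟨f !₂[1, 0], f !₂[0, 1], s, ?_, ?_, ?_, ?_⟩ <;> rw [← hf]
  · exact hs _ (left_mem_segment ℝ _ _)
  · exact hs _ (right_mem_segment ℝ _ _)
  · exact hst.trans (ht _ (left_mem_segment ℝ _ _))
  · exact hst.trans (ht _ (right_mem_segment ℝ _ _))

/-- Every configuration has a perturbation in general position which does not create crossings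
between disjoint segments. -/
theorem exists_generic_perturbation {n : ℕ} (p : Fin n → Plane) : ∃ q : Fin n → Plane,
    (∀ i j k, i ≠ j → i ≠ k → j ≠ k → orient (q i) (q j) (q k) ≠ 0) ∧
    ∀ u v x y, u ≠ v → x ≠ y → u ≠ x → u ≠ y → v ≠ x → v ≠ y →
      Disjoint (segment ℝ (p u) (p v)) (segment ℝ (p x) (p y)) →
      crossing (q u) (q v) (q x) (q y) = false := by
  set q : ℝ → Fin n → Plane := fun t i =>
    !₂[p i 0 + t * ((i : ℕ) : ℝ), p i 1 + t * ((i : ℕ) : ℝ) ^ 2] with hq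
  have hgen : ∀ᶠ t in 𝓝[>] (0 : ℝ), ∀ i j k, i ≠ j → i ≠ k → j ≠ k →
      orient (q t i) (q t j) (q t k) ≠ 0 := by
    simp only [eventually_all]
    intro i j k hij hik hjk
    have hV : ((j : ℕ) - (i : ℕ) : ℝ) * (((k : ℕ) : ℝ) ^ 2 - ((i : ℕ) : ℝ) ^ 2) -
        (((j : ℕ) : ℝ) ^ 2 - ((i : ℕ) : ℝ) ^ 2) * ((k : ℕ) - (i : ℕ) : ℝ) ≠ 0 := by
      have e : ((j : ℕ) - (i : ℕ) : ℝ) * (((k : ℕ) : ℝ) ^ 2 - ((i : ℕ) : ℝ) ^ 2) -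
        (((j : ℕ) : ℝ) ^ 2 - ((i : ℕ) : ℝ) ^ 2) * ((k : ℕ) - (i : ℕ) : ℝ) =
        ((j : ℕ) - (i : ℕ) : ℝ) * ((k : ℕ) - (i : ℕ) : ℝ) * ((k : ℕ) - (j : ℕ) : ℝ) := by ring
      rw [e]
      have hne : ∀ a b : Fin n, a ≠ b → ((a : ℕ) - (b : ℕ) : ℝ) ≠ 0 := fun a b hab =>
        sub_ne_zero.2 fun h => hab (Fin.ext (Nat.cast_injective h))
      exact mul_ne_zero (mul_ne_zero (hne _ _ hij.symm) (hne _ _ hik.symm)) (hne _ _ hjk.symm)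
    set V := ((j : ℕ) - (i : ℕ) : ℝ) * (((k : ℕ) : ℝ) ^ 2 - ((i : ℕ) : ℝ) ^ 2) -
        (((j : ℕ) : ℝ) ^ 2 - ((i : ℕ) : ℝ) ^ 2) * ((k : ℕ) - (i : ℕ) : ℝ) with hVd
    obtain ⟨A, B, hAB⟩ : ∃ A B : ℝ, ∀ t, orient (q t i) (q t j) (q t k) = A + B * t + V * t ^ 2 :=
      ⟨orient (p i) (p j) (p k),
        (p j 0 - p i 0) * (((k : ℕ) : ℝ) ^ 2 - ((i : ℕ) : ℝ) ^ 2) +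
          ((j : ℕ) - (i : ℕ) : ℝ) * (p k 1 - p i 1) -
          ((p j 1 - p i 1) * ((k : ℕ) - (i : ℕ) : ℝ) +
          (((j : ℕ) : ℝ) ^ 2 - ((i : ℕ) : ℝ) ^ 2) * (p k 0 - p i 0)), fun t => by
        simp [hq, orient, hVd]
        ring⟩
    set P : Polynomial ℝ := Polynomial.C A + Polynomial.C B * Polynomial.X +
      Polynomial.C V * Polynomial.X ^ 2 with hP
    have hP0 : P ≠ 0 := by
      intro h0
      have := congrArg (fun r => Polynomial.coeff r 2) h0
      simp [hP] at this
      exact hV this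
    have hfin : (P.roots.toFinset : Set ℝ).Finite := Finset.finite_toSet _
    have hnear : ((P.roots.toFinset : Set ℝ) \ {0})ᶜ ∈ 𝓝 (0 : ℝ) :=
      hfin.sdiff.isClosed.isOpen_compl.mem_nhds (by simp)
    filter_upwards [nhdsWithin_le_nhds hnear, self_mem_nhdsWithin] with t ht htpos h0
    refine ht ⟨?_, htpos.ne'⟩
    simp only [Finset.mem_coe, Multiset.mem_toFinset, Polynomial.mem_roots hP0, Polynomial.IsRoot]
    rw [← h0, hAB]
    simp [hP]
  have hsep : ∀ᶠ t in 𝓝[>] (0 : ℝ), ∀ u v x y,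
      Disjoint (segment ℝ (p u) (p v)) (segment ℝ (p x) (p y)) →
      ∃ α β s : ℝ, α * q t u 0 + β * q t u 1 < s ∧ α * q t v 0 + β * q t v 1 < s ∧
        s < α * q t x 0 + β * q t x 1 ∧ s < α * q t y 0 + β * q t y 1 := by
    simp only [eventually_all]
    intro u v x y h
    obtain ⟨α, β, s, hu, hv, hx, hy⟩ := exists_separating_line h
    have hlim : ∀ i, Tendsto (fun t => α * q t i 0 + β * q t i 1) (𝓝[>] 0)
        (𝓝 (α * p i 0 + β * p i 1)) := by
      intro i
      have hcont : Continuous fun t => α * q t i 0 + β * q t i 1 := by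
        simp only [hq]
        simp
        fun_prop
      refine (hcont.tendsto' 0 _ ?_).mono_left nhdsWithin_le_nhds
      simp [hq]
    filter_upwards [(hlim u).eventually_lt_const hu, (hlim v).eventually_lt_const hv,
      (hlim x).eventually_const_lt hx, (hlim y).eventually_const_lt hy] with t h1 h2 h3 h4
    exact ⟨α, β, s, h1, h2, h3, h4⟩
  obtain ⟨t, ht, ht'⟩ := (hgen.and hsep).exists
  refine ⟨q t, ht, fun u v x y huv hxy hux huy hvx hvy h => ?_⟩
  obtain ⟨α, β, s, h1, h2, h3, h4⟩ := ht' u v x y h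
  exact crossing_eq_false_of_separated (ht _ _ _ huv hux hvx) (ht _ _ _ huv huy hvy)
    (ht _ _ _ hxy hux.symm huy.symm) (ht _ _ _ hxy hvx.symm hvy.symm) h1 h2 h3 h4

end

open MvPolynomial in
/-- The orientation of the points `i`, `j`, `k` as a polynomial in the coordinates. -/
def orientPoly {n : ℕ} (i j k : Fin n) : MvPolynomial (Fin n × Fin 2) ℝ :=
  (X (j, 0) - X (i, 0)) * (X (k, 1) - X (i, 1)) - (X (j, 1) - X (i, 1)) * (X (k, 0) - X (i, 0))

open MvPolynomial in
theorem eval_orientPoly {n : ℕ} (q : Fin n → Plane) (i j k : Fin n) :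
    eval (fun a => q a.1 a.2) (orientPoly i j k) = orient (q i) (q j) (q k) := by
  simp [orientPoly, orient]

open MvPolynomial in
theorem degreeOf_X_sub_X_le {n : ℕ} (i j : Fin n) (e : Fin 2) (l : Fin n × Fin 2) :
    degreeOf l (X (j, e) - X (i, e) : MvPolynomial (Fin n × Fin 2) ℝ) ≤
      if l.2 = e ∧ (l.1 = j ∨ l.1 = i) then 1 else 0 := by
  refine (degreeOf_sub_le _ _ _).trans ?_
  rw [degreeOf_X, degreeOf_X]
  obtain ⟨a, b⟩ := l
  simp only [Prod.mk.injEq]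
  grind

open MvPolynomial in
theorem degreeOf_orientPoly_le {n : ℕ} (i j k : Fin n) (l : Fin n × Fin 2) :
    degreeOf l (orientPoly i j k) ≤ if i = l.1 ∨ j = l.1 ∨ k = l.1 then 1 else 0 := by
  refine (degreeOf_sub_le _ _ _).trans (max_le ?_ ?_)
  · refine (degreeOf_mul_le _ _ _).trans ((add_le_add (degreeOf_X_sub_X_le _ _ _ _)
      (degreeOf_X_sub_X_le _ _ _ _)).trans ?_)
    grind
  · refine (degreeOf_mul_le _ _ _).trans ((add_le_add (degreeOf_X_sub_X_le _ _ _ _)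
      (degreeOf_X_sub_X_le _ _ _ _)).trans ?_)
    grind

open MvPolynomial in
theorem pderiv_orientPoly {n : ℕ} (i j k : Fin n) (l : Fin n × Fin 2)
    (h : ¬ (i = l.1 ∨ j = l.1 ∨ k = l.1)) : pderiv l (orientPoly i j k) = 0 := by
  push Not at h
  have hX : ∀ (a : Fin n) (e : Fin 2), a ≠ l.1 →
      pderiv l (X (a, e) : MvPolynomial (Fin n × Fin 2) ℝ) = 0 := fun a e ha =>
    pderiv_X_of_ne fun h => ha (congrArg Prod.fst h)
  simp [orientPoly, hX, h]

/-- The point `a` occurs in the triple `t`. -/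
def occurs {n : ℕ} (a : Fin n) (t : Fin n × Fin n × Fin n) : Prop :=
  t.1 = a ∨ t.2.1 = a ∨ t.2.2 = a

instance {n : ℕ} (a : Fin n) : DecidablePred (occurs a) := fun t => by
  unfold occurs
  infer_instance

theorem card_occurs_le {n : ℕ} (a : Fin n) :
    (Finset.univ.filter (occurs a)).card ≤ 3 * n ^ 2 := by
  have hsub : Finset.univ.filter (occurs a) ⊆
      (Finset.univ.image fun x : Fin n × Fin n => (a, x.1, x.2)) ∪
      ((Finset.univ.image fun x : Fin n × Fin n => (x.1, a, x.2)) ∪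
      (Finset.univ.image fun x : Fin n × Fin n => (x.1, x.2, a))) := by
    rintro ⟨x, y, z⟩ h
    simp only [occurs, Finset.mem_filter, Finset.mem_univ, true_and] at h
    simp only [Finset.mem_union, Finset.mem_image, Finset.mem_univ, true_and, Prod.mk.injEq,
      Prod.exists]
    grind
  have hcard : Fintype.card (Fin n × Fin n) = n ^ 2 := by simp [sq]
  have himg : ∀ f : Fin n × Fin n → Fin n × Fin n × Fin n, (Finset.univ.image f).card ≤ n ^ 2 :=
    fun f => Finset.card_image_le.trans (by rw [Finset.card_univ, hcard])
  refine (Finset.card_le_card hsub).trans ((Finset.card_union_le _ _).trans ?_)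
  have h1 := himg fun x => (a, x.1, x.2)
  have h2 := (Finset.card_union_le (Finset.univ.image fun x : Fin n × Fin n => (x.1, a, x.2))
    (Finset.univ.image fun x : Fin n × Fin n => (x.1, x.2, a))).trans
    (add_le_add (himg _) (himg _))
  omega

theorem card_occurs_swap_le {n : ℕ} (t : Fin n × Fin n × Fin n) :
    (Finset.univ.filter fun i : Fin n × Fin 2 => occurs i.1 t).card ≤ 6 := by
  have hsub : (Finset.univ.filter fun i : Fin n × Fin 2 => occurs i.1 t) ⊆
      ({t.1, t.2.1, t.2.2} : Finset (Fin n)) ×ˢ (Finset.univ : Finset (Fin 2)) := by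
    rintro ⟨a, e⟩ h
    simp only [occurs] at h
    simp only [Finset.mem_product, Finset.mem_insert, Finset.mem_singleton, Finset.mem_univ]
    grind
  refine (Finset.card_le_card hsub).trans ?_
  rw [Finset.card_product, Finset.card_univ, Fintype.card_fin]
  have := Finset.card_le_three (a := t.1) (b := t.2.1) (c := t.2.2)
  omega

open MvPolynomial in
/-- A bound on the number of order types of `n` labelled points in general position. -/
theorem card_lt_of_order_types_ne {n : ℕ} [NeZero n] {S : Type*} [Fintype S]
    (q : S → Fin n → Plane)
    (hgen : ∀ s i j k, i ≠ j → i ≠ k → j ≠ k → orient (q s i) (q s j) (q s k) ≠ 0)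
    (hsep : ∀ s t, s ≠ t → ∃ i j k, i ≠ j ∧ i ≠ k ∧ j ≠ k ∧
      ccw (q s i) (q s j) (q s k) ≠ ccw (q t i) (q t j) (q t k)) :
    Fintype.card S < (18 * n ^ 2 + 2) ^ (2 * n) := by
  classical
  set f : Fin n × Fin n × Fin n → MvPolynomial (Fin n × Fin 2) ℝ := fun t =>
    if t.1 ≠ t.2.1 ∧ t.1 ≠ t.2.2 ∧ t.2.1 ≠ t.2.2 then orientPoly t.1 t.2.1 t.2.2 else 1 with hf
  have hdeg : ∀ t l, degreeOf l (f t) ≤ if occurs l.1 t then 1 else 0 := by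
    intro t l
    simp only [hf]
    split_ifs with h₁ h₂ h₂
    · exact (degreeOf_orientPoly_le _ _ _ l).trans (if_pos h₂).le
    · exact (degreeOf_orientPoly_le _ _ _ l).trans (if_neg h₂).le
    · simp
    · simp
  have key := card_lt_of_sign_separated f (fun i => ∏ t with occurs i.1 t, f t)
    (fun i => ∏ t with ¬ occurs i.1 t, f t)
    (fun i => (Finset.prod_filter_mul_prod_filter_not _ _ _).symm) ?_ (18 * n ^ 2) ?_
    (fun s a => q s a.1 a.2) ?_ ?_
  · rwa [Fintype.card_prod, Fintype.card_fin, Fintype.card_fin, mul_comm n 2] at key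
  · intro i
    refine Finset.prod_induction f (fun p => pderiv i p = 0) (fun a b ha hb => ?_) ?_ fun t ht => ?_
    · simp [ha, hb]
    · simp
    · simp only [hf]
      split_ifs
      · exact pderiv_orientPoly _ _ _ i (Finset.mem_filter.1 ht).2
      · simp
  · intro l
    calc ∑ i : Fin n × Fin 2, degreeOf l (∏ t with occurs i.1 t, f t)
        ≤ ∑ i : Fin n × Fin 2, ∑ t with occurs i.1 t, if occurs l.1 t then 1 else 0 :=
          Finset.sum_le_sum fun i _ => (degreeOf_prod_le _ _ _).trans
            (Finset.sum_le_sum fun t _ => hdeg t l)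
      _ = ∑ t with occurs l.1 t, (Finset.univ.filter fun i : Fin n × Fin 2 => occurs i.1 t).card
        := by
          simp only [Finset.sum_filter, Finset.card_filter]
          rw [Finset.sum_comm]
          refine Finset.sum_congr rfl fun t _ => ?_
          split_ifs <;> simp
      _ ≤ (Finset.univ.filter (occurs l.1)).card * 6 :=
          Finset.sum_le_card_nsmul _ _ _ fun t _ => card_occurs_swap_le t
      _ ≤ 18 * n ^ 2 := by
          have := card_occurs_le l.1
          omega
  · intro s t
    simp only [hf]
    split_ifs with h
    · rw [eval_orientPoly]
      exact hgen s _ _ _ h.1 h.2.1 h.2.2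
    · simp
  · intro s t hst
    obtain ⟨i, j, k, hij, hik, hjk, hne⟩ := hsep s t hst
    refine ⟨(i, j, k), ?_⟩
    simp only [hf]
    rw [if_pos ⟨hij, hik, hjk⟩, eval_orientPoly, eval_orientPoly]
    have h1 := hgen s i j k hij hik hjk
    have h2 := hgen t i j k hij hik hjk
    have h3 := ccw_beq h1 h2
    rw [beq_eq_false_iff_ne.2 hne, eq_comm, decide_eq_false_iff_not, not_lt] at h3
    exact h3.lt_of_ne (mul_ne_zero h1 h2)

/-- Codes of stacked triangulations with `M + 3` vertices. -/
abbrev Code (M : ℕ) := ∀ i : Fin M, Fin (2 * i + 1)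

/-- Extend a code by zero. -/
def Code.extend {M : ℕ} (a : Code M) (m : ℕ) : ℕ :=
  if h : m < M then a ⟨m, h⟩ else 0

theorem Code.extend_lt {M : ℕ} (a : Code M) (m : ℕ) : a.extend m < 2 * m + 1 := by
  unfold Code.extend
  split_ifs with h
  · exact (a ⟨m, h⟩).2
  · omega

/-- No two vertex-disjoint edges of `G` cross when the vertices are placed according to `q`. -/
def NoCrossing {V : Type*} (G : SimpleGraph V) (q : V → Plane) : Prop :=
  ∀ u v x y, G.Adj u v → G.Adj x y → u ≠ x → u ≠ y → v ≠ x → v ≠ y →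
    crossing (q u) (q v) (q x) (q y) = false

theorem Code.eq_of_noCrossing {M : ℕ} {a b : Code M} {q q' : Fin (M + 3) → Plane}
    (hq : ∀ i j k, i ≠ j → i ≠ k → j ≠ k → orient (q i) (q j) (q k) ≠ 0)
    (hqq' : ∀ i j k, i ≠ j → i ≠ k → j ≠ k →
      ccw (q i) (q j) (q k) = ccw (q' i) (q' j) (q' k))
    (ha : NoCrossing (stackGraph a.extend (M + 3)) q)
    (hb : NoCrossing (stackGraph b.extend (M + 3)) q') : a = b := by
  have hb' : NoCrossing (stackGraph b.extend (M + 3)) q := by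
    intro u v x y huv hxy hux huy hvx hvy
    rw [← hb u v x y huv hxy hux huy hvx hvy]
    unfold crossing
    rw [hqq' u v x huv.ne hux hvx, hqq' u v y huv.ne huy hvy,
      hqq' x y u hxy.ne hux.symm huy.symm, hqq' x y v hxy.ne hvx.symm hvy.symm]
  set Q : ℕ → Plane := Function.extend Fin.val q 0
  have hQ : ∀ (i : ℕ) (hi : i < M + 3), Q i = q ⟨i, hi⟩ := fun i hi =>
    Fin.val_injective.extend_apply q 0 ⟨i, hi⟩
  have hcf : ∀ a : Code M, NoCrossing (stackGraph a.extend (M + 3)) q →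
      CrossingFree a.extend (M + 3) Q := by
    intro a ha u v x y hu hv hx hy huv hxy hux huy hvx hvy
    rw [hQ u hu, hQ v hv, hQ x hx, hQ y hy]
    exact ha _ _ _ _ huv hxy (by simpa using hux) (by simpa using huy) (by simpa using hvx)
      (by simpa using hvy)
  have hgen : IsGeneric (M + 3) Q := by
    intro i j k hi hj hk hij hik hjk
    rw [hQ i hi, hQ j hj, hQ k hk]
    exact hq _ _ _ (by simpa using hij) (by simpa using hik) (by simpa using hjk)
  funext i
  have := (hcf a ha).code_eq a.extend_lt b.extend_lt hgen (hcf b hb') i (by omega)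
  simpa [Code.extend, Fin.ext_iff] using this

theorem IsSLEmbedding.disjoint_segment {V : Type*} {G : SimpleGraph V} {π : V → Plane}
    (h : IsSLEmbedding G π) {u v x y : V} (huv : G.Adj u v) (hxy : G.Adj x y) (hux : u ≠ x)
    (huy : u ≠ y) (hvx : v ≠ x) (hvy : v ≠ y) :
    Disjoint (segment ℝ (π u) (π v)) (segment ℝ (π x) (π y)) := by
  rw [Set.disjoint_iff]
  refine (h.2.1 u v x y huv hxy fun he => ?_).trans ?_
  · rcases Sym2.eq_iff.1 he with he | he
    · exact hux he.1
    · exact huy he.1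
  · rintro _ ⟨z, ⟨hz, hz'⟩, -⟩
    simp only [Set.mem_insert_iff, Set.mem_singleton_iff] at hz hz'
    grind

/-- Simultaneously embeddable graphs can be drawn on the same points in general position, up to
relabellings of which the first one is trivial. -/
theorem exists_generic_of_simultaneouslyEmbeddable {n k : ℕ} (G : Fin (k + 1) → SimpleGraph (Fin n))
    (h : SimultaneouslyEmbeddable (Set.range G)) :
    ∃ σ : Fin k → Equiv.Perm (Fin n), ∃ q : Fin n → Plane,
      (∀ i j k, i ≠ j → i ≠ k → j ≠ k → orient (q i) (q j) (q k) ≠ 0) ∧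
      NoCrossing (G 0) q ∧ ∀ j, NoCrossing (G j.succ) (q ∘ σ j) := by
  obtain ⟨P, -, hP⟩ := h
  choose π hπ hrange using fun j => hP (G j) ⟨j, rfl⟩
  obtain ⟨q, hq, hcross⟩ := exists_generic_perturbation (π 0)
  have hσ : ∀ j : Fin k, ∃ σ : Equiv.Perm (Fin n), ∀ i, π 0 (σ i) = π j.succ i := by
    intro j
    have hex : ∀ i, ∃ i', π 0 i' = π j.succ i := fun i => by
      have : π j.succ i ∈ Set.range (π 0) := by
        rw [hrange, ← hrange j.succ]
        exact ⟨i, rfl⟩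
      exact this
    choose g hg using hex
    have hinj : Function.Injective g := fun a b hab => (hπ j.succ).1 (by rw [← hg, ← hg, hab])
    exact ⟨Equiv.ofBijective g (Finite.injective_iff_bijective.1 hinj), hg⟩
  choose σ hσ using hσ
  refine ⟨σ, q, hq, ?_, ?_⟩
  · intro u v x y huv hxy hux huy hvx hvy
    exact hcross u v x y huv.ne hxy.ne hux huy hvx hvy
      ((hπ 0).disjoint_segment huv hxy hux huy hvx hvy)
  · intro j u v x y huv hxy hux huy hvx hvy
    have hne : ∀ a b, a ≠ b → σ j a ≠ σ j b := fun a b hab => (σ j).injective.ne hab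
    refine hcross _ _ _ _ (hne _ _ huv.ne) (hne _ _ hxy.ne) (hne _ _ hux) (hne _ _ huy)
      (hne _ _ hvx) (hne _ _ hvy) ?_
    rw [hσ, hσ, hσ, hσ]
    exact (hπ j.succ).disjoint_segment huv hxy hux huy hvx hvy

theorem card_code_pow_le {M k : ℕ}
    (h : ∀ τ : Fin (k + 1) → Code M,
      SimultaneouslyEmbeddable (Set.range fun j => stackGraph (τ j).extend (M + 3))) :
    (∏ i : Fin M, (2 * (i : ℕ) + 1)) ^ (k + 1) ≤
      (18 * (M + 3) ^ 2 + 2) ^ (2 * (M + 3)) * (M + 3).factorial ^ k := by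
  classical
  choose σ q hgen hzero hsucc using fun τ => exists_generic_of_simultaneouslyEmbeddable _ (h τ)
  have hfib : ∀ s : Fin k → Equiv.Perm (Fin (M + 3)),
      (Finset.univ.filter fun τ => σ τ = s).card ≤ (18 * (M + 3) ^ 2 + 2) ^ (2 * (M + 3)) := by
    intro s
    have := card_lt_of_order_types_ne (S := {τ // σ τ = s}) (fun τ => q τ) (fun τ => hgen τ) ?_
    · rw [Fintype.card_subtype] at this
      exact this.le
    · rintro ⟨τ, hτ⟩ ⟨τ', hτ'⟩ hne
      by_contra! hcon
      refine hne (Subtype.ext (funext fun j => ?_))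
      refine Fin.cases ?_ (fun j => ?_) j
      · exact Code.eq_of_noCrossing (hgen τ) hcon (hzero τ) (hzero τ')
      · have h1 := hsucc τ j
        have h2 := hsucc τ' j
        rw [hτ] at h1
        rw [hτ'] at h2
        have hinj := (s j).injective
        exact Code.eq_of_noCrossing
          (fun _ _ _ h h' h'' => hgen τ _ _ _ (hinj.ne h) (hinj.ne h') (hinj.ne h''))
          (fun _ _ _ h h' h'' => hcon _ _ _ (hinj.ne h) (hinj.ne h') (hinj.ne h'')) h1 h2
  have hcard := Finset.card_le_mul_card_image (f := σ) Finset.univ _ fun s _ => hfib s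
  refine le_trans (le_of_eq ?_) (hcard.trans (Nat.mul_le_mul_left _ ((Finset.card_le_univ _).trans
    (le_of_eq ?_))))
  · rw [Finset.card_univ, Fintype.card_fun, Fintype.card_pi, Fintype.card_fin]
    simp
  · rw [Fintype.card_fun, Fintype.card_perm, Fintype.card_fin, Fintype.card_fin]

theorem two_pow_mul_factorial_le (M : ℕ) :
    2 ^ M * M.factorial ≤ (2 * M + 1) * ∏ i : Fin M, (2 * (i : ℕ) + 1) := by
  induction M with
  | zero => simp
  | succ M ih =>
    rw [Fin.prod_univ_castSucc, Nat.factorial_succ]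
    simp only [Fin.val_castSucc, Fin.val_last]
    calc 2 ^ (M + 1) * ((M + 1) * M.factorial) = 2 * (M + 1) * (2 ^ M * M.factorial) := by ring
      _ ≤ (2 * (M + 1) + 1) * ((2 * M + 1) * ∏ i : Fin M, (2 * (i : ℕ) + 1)) := by gcongr; omega
      _ = _ := by ring

theorem two_pow_mul_factorial_add_three_le (M : ℕ) :
    2 ^ (M + 3) * (M + 3).factorial ≤
      16 * (M + 3) ^ 4 * ∏ i : Fin M, (2 * (i : ℕ) + 1) := by
  have h := two_pow_mul_factorial_le M
  have hfac : (M + 3).factorial = (M + 3) * ((M + 2) * ((M + 1) * M.factorial)) := by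
    rw [Nat.factorial_succ, Nat.factorial_succ, Nat.factorial_succ]
  rw [hfac]
  calc 2 ^ (M + 3) * ((M + 3) * ((M + 2) * ((M + 1) * M.factorial)))
      = 8 * ((M + 3) * (M + 2) * (M + 1)) * (2 ^ M * M.factorial) := by ring
    _ ≤ 8 * ((M + 3) * (M + 3) * (M + 3)) *
        ((2 * (M + 3)) * ∏ i : Fin M, (2 * (i : ℕ) + 1)) := by
      refine Nat.mul_le_mul (Nat.mul_le_mul_left _ (Nat.mul_le_mul (Nat.mul_le_mul le_rfl ?_) ?_))
        (h.trans (Nat.mul_le_mul_right _ ?_)) <;> omega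
    _ = _ := by ring

/-- The counting inequality in logarithmic form. -/
theorem log_bound_of_counting {n k F : ℕ} (hn : 1 ≤ n)
    (hF : 2 ^ n * n.factorial ≤ 16 * n ^ 4 * F)
    (hcount : F ^ (k + 1) ≤ (18 * n ^ 2 + 2) ^ (2 * n) * n.factorial ^ k) :
    (k + 1 : ℝ) * (n * Real.log 2) ≤
      (k + 1) * (Real.log 16 + 4 * Real.log n) + n * (1 + Real.log 400) +
        3 * (n * Real.log n) := by
  have hfac : 0 < n.factorial := n.factorial_pos
  have h1 : 2 ^ (n * (k + 1)) * n.factorial ≤ (16 * n ^ 4) ^ (k + 1) * (20 * n ^ 2) ^ (2 * n) := by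
    refine Nat.le_of_mul_le_mul_right ?_ (pow_pos hfac k)
    calc 2 ^ (n * (k + 1)) * n.factorial * n.factorial ^ k
        = (2 ^ n * n.factorial) ^ (k + 1) := by rw [pow_mul]; ring
      _ ≤ (16 * n ^ 4 * F) ^ (k + 1) := by gcongr
      _ = (16 * n ^ 4) ^ (k + 1) * F ^ (k + 1) := by ring
      _ ≤ (16 * n ^ 4) ^ (k + 1) * ((18 * n ^ 2 + 2) ^ (2 * n) * n.factorial ^ k) := by gcongr
      _ ≤ (16 * n ^ 4) ^ (k + 1) * ((20 * n ^ 2) ^ (2 * n) * n.factorial ^ k) := by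
          gcongr
          nlinarith
      _ = _ := by ring
  have hn0 : (0 : ℝ) < n := by exact_mod_cast hn
  have hfac0 : (0 : ℝ) < n.factorial := by exact_mod_cast hfac
  have h2 : (2 : ℝ) ^ (n * (k + 1)) * n.factorial ≤
      (16 * n ^ 4) ^ (k + 1) * (20 * n ^ 2) ^ (2 * n) := by exact_mod_cast h1
  have h3 := Real.log_le_log (by positivity) h2
  have h4 := Real.pow_div_factorial_le_exp (n : ℝ) hn0.le n
  rw [div_le_iff₀ hfac0] at h4
  have h5 := Real.log_le_log (by positivity) h4
  rw [Real.log_mul (by positivity) (by positivity), Real.log_exp, Real.log_pow] at h5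
  rw [Real.log_mul (by positivity) (by positivity), Real.log_mul (by positivity) (by positivity),
    Real.log_pow, Real.log_pow, Real.log_pow, Real.log_mul (by positivity) (by positivity),
    Real.log_mul (by positivity) (by positivity), Real.log_pow, Real.log_pow] at h3
  have h400 : Real.log 400 = 2 * Real.log 20 := by
    rw [show (400 : ℝ) = 20 ^ 2 by norm_num, Real.log_pow]
    norm_num
  rw [h400]
  push_cast at h3
  nlinarith

open Filter Asymptotics in
theorem eventually_lt_of_floor (ε : ℝ) (hε : 0 < ε) : ∀ᶠ n : ℕ in atTop, 4 ≤ n ∧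
    ∀ k : ℕ, k + 1 = ⌊(3 + ε) * Real.logb 2 n⌋₊ →
      (k + 1) * (Real.log 16 + 4 * Real.log n) + n * (1 + Real.log 400) +
        3 * (n * Real.log n) < (k + 1 : ℝ) * (n * Real.log 2) := by
  have hlog2 : 0 < Real.log 2 := Real.log_pos (by norm_num)
  have hlog16 : 0 < Real.log 16 := Real.log_pos (by norm_num)
  set A := (3 + ε) / Real.log 2 * (Real.log 16 + 4) with hA
  have hApos : 0 < A := by positivity
  have hlim : Tendsto (fun n : ℕ => Real.log n) atTop atTop :=
    Real.tendsto_log_atTop.comp tendsto_natCast_atTop_atTop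
  have hsq : ∀ᶠ n : ℕ in atTop, Real.log n ^ 2 ≤ A⁻¹ * n := by
    have h := (Real.isLittleO_pow_log_id_atTop (n := 2)).bound (inv_pos.2 hApos)
    filter_upwards [tendsto_natCast_atTop_atTop.eventually h] with n hn
    simpa using hn
  filter_upwards [eventually_ge_atTop 4, hsq, hlim.eventually_ge_atTop 1,
    hlim.eventually_gt_atTop ((2 + Real.log 400 + Real.log 2) / ε)] with n hn4 hsq h1 hbig
  refine ⟨hn4, fun k hk => ?_⟩
  have hn0 : (0 : ℝ) < n := by positivity
  set ℓ := Real.log n with hℓ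
  have hlogb : Real.logb 2 n = ℓ / Real.log 2 := rfl
  have hle : (k + 1 : ℝ) ≤ (3 + ε) * (ℓ / Real.log 2) := by
    have := Nat.floor_le (a := (3 + ε) * Real.logb 2 n) (by rw [hlogb]; positivity)
    rw [← hk, hlogb] at this
    exact_mod_cast this
  have hlt : (3 + ε) * (ℓ / Real.log 2) < (k + 1 : ℝ) + 1 := by
    have := Nat.lt_floor_add_one ((3 + ε) * Real.logb 2 n)
    rw [← hk, hlogb] at this
    exact_mod_cast this
  have hlt' : (3 + ε) * ℓ < (k + 1 : ℝ) * Real.log 2 + Real.log 2 := by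
    have := mul_lt_mul_of_pos_right hlt hlog2
    rw [mul_assoc, div_mul_cancel₀ _ hlog2.ne'] at this
    linarith
  have hsmall : (k + 1 : ℝ) * (Real.log 16 + 4 * ℓ) ≤ n := by
    calc (k + 1 : ℝ) * (Real.log 16 + 4 * ℓ)
        ≤ ((3 + ε) * (ℓ / Real.log 2)) * ((Real.log 16 + 4) * ℓ) := by
          gcongr
          nlinarith
      _ = A * ℓ ^ 2 := by rw [hA]; ring
      _ ≤ A * (A⁻¹ * n) := by gcongr
      _ = n := by field_simp
  rw [div_lt_iff₀ hε] at hbig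
  nlinarith [mul_lt_mul_of_pos_left hlt' hn0, mul_lt_mul_of_pos_left hbig hn0]

/-- For every `ε > 0`, for all sufficiently large `n` there exists a conflict collection
of `n`-vertex graphs of cardinality at most `(3 + ε) * log₂ n`. -/
theorem conflict_collection_log (ε : ℝ) (hε : 0 < ε) :
    ∃ N : ℕ, ∀ n : ℕ, N ≤ n →
      ∃ 𝒢 : Finset (SimpleGraph (Fin n)),
        ConflictCollection (↑𝒢 : Set (SimpleGraph (Fin n))) ∧
        (𝒢.card : ℝ) ≤ (3 + ε) * Real.logb 2 n := by
  classical
  obtain ⟨N, hN⟩ := Filter.eventually_atTop.1 (eventually_lt_of_floor ε hε)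
  refine ⟨N, fun n hn => ?_⟩
  obtain ⟨hn4, hfloor⟩ := hN n hn
  obtain ⟨M, rfl⟩ : ∃ M, n = M + 3 := ⟨n - 3, by omega⟩
  have hlogb : 1 ≤ Real.logb 2 ((M + 3 : ℕ) : ℝ) := by
    rw [Real.le_logb_iff_rpow_le (by norm_num) (by positivity), Real.rpow_one]
    exact_mod_cast (by omega : 2 ≤ M + 3)
  have hpos : 1 ≤ ⌊(3 + ε) * Real.logb 2 ((M + 3 : ℕ) : ℝ)⌋₊ :=
    Nat.le_floor (by push_cast at hlogb ⊢; nlinarith)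
  obtain ⟨k, hk⟩ := Nat.exists_eq_add_of_le' hpos
  have hτ : ∃ τ : Fin (k + 1) → Code M,
      ¬ SimultaneouslyEmbeddable (Set.range fun j => stackGraph (τ j).extend (M + 3)) := by
    by_contra! h
    have hlog := log_bound_of_counting (by omega) (two_pow_mul_factorial_add_three_le M)
      (card_code_pow_le h)
    exact absurd hlog (not_le.2 (hfloor k hk.symm))
  obtain ⟨τ, hτ⟩ := hτ
  refine ⟨Finset.univ.image fun j => stackGraph (τ j).extend (M + 3), ⟨fun G hG => ?_, ?_⟩, ?_⟩
  · obtain ⟨j, -, rfl⟩ := Finset.mem_image.1 (Finset.mem_coe.1 hG)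
    exact planarEmbeddable_stackGraph (τ j).extend_lt M
  · rwa [Finset.coe_image, Finset.coe_univ, Set.image_univ]
  · have hcard : (Finset.univ.image fun j => stackGraph (τ j).extend (M + 3)).card ≤ k + 1 :=
      Finset.card_image_le.trans (by simp)
    exact (Nat.cast_le.2 (hcard.trans hk.ge)).trans
      (Nat.floor_le (mul_nonneg (by positivity) (zero_le_one.trans hlogb)))
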